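/- There exist constants C₁, C₂ > 0 such that for all real numbers 0 < a < b the following two assertions hold: (i) for all bounded self-adjoint operators A, B on any complex Hilbert space with spectra contained in (−∞, 0] ∪ [a, b], one has ‖ |A| − |B| ‖ ≤ C₂ · log(2 + log(b/a)) · ‖A − B‖; (ii) there exist bounded self-adjoint operators A, B on ℓ²(ℕ, ℂ) with spectra contained in (−∞, 0] ∪ [a, b], with A ≠ B, such that ‖ |A| − |B| ‖ ≥ C₁ · log(2 + log(b/a)) · ‖A − B‖. -/

import Mathlib

open MeasureTheory ENNReal

/-- `|T| = (T*T)^{1/2}` via the continuous functional calculus. -/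
noncomputable def opAbs {H : Type} [NormedAddCommGroup H] [InnerProductSpace ℂ H]
    [CompleteSpace H] (T : H →L[ℂ] H) : H →L[ℂ] H :=
  cfc Real.sqrt (star T * T)

/-- The Hilbert space `ℓ²(ℕ, ℂ)`. -/
noncomputable abbrev ellTwo : Type := lp (fun _ : ℕ => ℂ) 2

section DiagonalMultipliers

variable {ι : Type*} {E : Type*} [NormedAddCommGroup E] [InnerProductSpace ℂ E]
  {D : (ι → ℝ) →ₐ[ℝ] (E →L[ℂ] E)}

lemma norm_compress_le (P Q T : E →L[ℂ] E) (hP : ‖P‖ ≤ 1) (hQ : ‖Q‖ ≤ 1) :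
    ‖P * T * Q‖ ≤ ‖T‖ := by
  calc ‖P * T * Q‖ ≤ ‖P‖ * ‖T‖ * ‖Q‖ :=
        (norm_mul_le _ _).trans (by gcongr; exact norm_mul_le _ _)
    _ ≤ 1 * ‖T‖ * 1 := by gcongr
    _ = ‖T‖ := by ring

lemma map_compress_mul {f f₁ e : ι → ℝ} (e' : ι → ℝ) (hf : f * e = f₁ * e) (Z : E →L[ℂ] E) :
    D e * (D f * Z) * D e' = D f₁ * (D e * Z * D e') := by
  have h : D e * D f = D f₁ * D e := by rw [← map_mul, mul_comm, hf, map_mul]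
  simp only [← mul_assoc, h]

lemma mul_map_compress {g g₁ e' : ι → ℝ} (e : ι → ℝ) (hg : g * e' = g₁ * e')
    (Z : E →L[ℂ] E) :
    D e * (Z * D g) * D e' = D e * Z * D e' * D g₁ := by
  have h : D g * D e' = D e' * D g₁ := by rw [← map_mul, hg, mul_comm, map_mul]
  simp only [mul_assoc, h]

lemma sylvester_compress {f f₁ g g₁ e e' : ι → ℝ} (hf : f * e = f₁ * e) (hg : g * e' = g₁ * e')
    (Z : E →L[ℂ] E) :
    D f₁ * (D e * Z * D e') + D e * Z * D e' * D g₁ = D e * (D f * Z + Z * D g) * D e' := by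
  rw [mul_add, add_mul, map_compress_mul e' hf, mul_map_compress e hg]

lemma eq_sum_blocks (e e' : ι → ℝ) (T : E →L[ℂ] E) :
    T = (D e * T * D e' + D (1 - e) * T * D (1 - e')) +
      (D e * T * D (1 - e') + D (1 - e) * T * D e') := by
  simp only [map_sub, map_one]
  noncomm_ring

variable [CompleteSpace E]

/-- Pythagoras for a self-adjoint idempotent. -/
lemma norm_sq_proj_add {P : E →L[ℂ] E} (hs : star P = P) (hi : P * P = P) (x y : E) :
    ‖P x + (1 - P) y‖ ^ 2 = ‖P x‖ ^ 2 + ‖(1 - P) y‖ ^ 2 := by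
  have hin : inner ℂ (P x) ((1 - P) y) = 0 := by
    rw [← hs, ContinuousLinearMap.star_eq_adjoint, ContinuousLinearMap.adjoint_inner_left,
      ← ContinuousLinearMap.star_eq_adjoint, hs, ← mul_apply_eq_comp,
      mul_sub, hi]
    simp
  have := norm_add_sq_eq_norm_sq_add_norm_sq_of_inner_eq_zero (𝕜 := ℂ) _ _ hin
  simpa [pow_two] using this

lemma norm_block_le {P Q U V : E →L[ℂ] E} (hP : star P = P) (hPi : P * P = P)
    (hQ : star Q = Q) (hQi : Q * Q = Q) {m : ℝ} (hU : ‖P * U * Q‖ ≤ m)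
    (hV : ‖(1 - P) * V * (1 - Q)‖ ≤ m) :
    ‖P * U * Q + (1 - P) * V * (1 - Q)‖ ≤ m := by
  have hm : 0 ≤ m := (norm_nonneg _).trans hU
  refine ContinuousLinearMap.opNorm_le_bound _ hm fun x => ?_
  have hQ' : (1 - Q) * (1 - Q) = 1 - Q := by
    rw [mul_sub, sub_mul, sub_mul, hQi]; simp
  have h1 : ‖P (U (Q x))‖ ≤ m * ‖Q x‖ := by
    have : P (U (Q x)) = (P * U * Q) (Q x) := by
      conv_lhs => rw [← hQi]
      rfl
    rw [this]
    exact ContinuousLinearMap.le_of_opNorm_le _ hU _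
  have h2 : ‖(1 - P) (V ((1 - Q) x))‖ ≤ m * ‖(1 - Q) x‖ := by
    have : (1 - P) (V ((1 - Q) x)) = ((1 - P) * V * (1 - Q)) ((1 - Q) x) := by
      conv_lhs => rw [← hQ']
      rfl
    rw [this]
    exact ContinuousLinearMap.le_of_opNorm_le _ hV _
  have h3 := norm_sq_proj_add hP hPi (U (Q x)) (V ((1 - Q) x))
  have h4 := norm_sq_proj_add hQ hQi x x
  have h5 : Q x + (1 - Q) x = x := by simp
  rw [h5] at h4
  have h6 : (P * U * Q + (1 - P) * V * (1 - Q)) x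
      = P (U (Q x)) + (1 - P) (V ((1 - Q) x)) := rfl
  rw [h6]
  refine (pow_le_pow_iff_left₀ (norm_nonneg _) (by positivity) two_ne_zero).1 ?_
  rw [h3, mul_pow, h4, mul_add, ← mul_pow, ← mul_pow]
  gcongr

/-- A representation of the functions on `ι` by self-adjoint operators of controlled norm. -/
structure IsDiagonalRep (D : (ι → ℝ) →ₐ[ℝ] (E →L[ℂ] E)) : Prop where
  star_eq : ∀ f, star (D f) = D f
  norm_le : ∀ f c, 0 ≤ c → (∀ i, |f i| ≤ c) → ‖D f‖ ≤ c

lemma IsDiagonalRep.mul_norm_le (hD : IsDiagonalRep D) {f g : ι → ℝ} {β M : ℝ}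
    (hf : ∀ i, 0 ≤ f i) (hfM : ∀ i, f i ≤ M) (hg : ∀ i, β ≤ g i) (hgM : ∀ i, g i ≤ M)
    (hM : 0 < M) (hβ : β ≤ M) (Z : E →L[ℂ] E) :
    β * ‖Z‖ ≤ ‖D f * Z + Z * D g‖ := by
  set W := D f * Z + Z * D g with hW
  have key : ∀ s : ℝ, 0 < s → s < M⁻¹ → β * ‖Z‖ ≤ ‖W‖ + s * ‖D f * Z * D g‖ := by
    intro s hs hsM
    have hsM' : s * M < 1 := by
      calc s * M < M⁻¹ * M := by gcongr
        _ = 1 := inv_mul_cancel₀ hM.ne'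
    have h1 : ‖D (1 - s • f)‖ ≤ 1 := by
      refine hD.norm_le _ _ zero_le_one fun i => ?_
      have h1 := mul_nonneg hs.le (hf i)
      have h2 := mul_le_mul_of_nonneg_left (hfM i) hs.le
      simp only [Pi.sub_apply, Pi.one_apply, Pi.smul_apply, smul_eq_mul]
      rw [abs_le]; constructor <;> linarith
    have h2 : ‖D (1 - s • g)‖ ≤ 1 - s * β := by
      have hsβ : s * β ≤ s * M := by gcongr
      refine hD.norm_le _ _ (by linarith) fun i => ?_
      have h1 := mul_le_mul_of_nonneg_left (hg i) hs.le
      have h2 := mul_le_mul_of_nonneg_left (hgM i) hs.le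
      simp only [Pi.sub_apply, Pi.one_apply, Pi.smul_apply, smul_eq_mul]
      rw [abs_le]; constructor <;> linarith
    have h3 : Z = D (1 - s • f) * Z * D (1 - s • g) + s • W - (s * s) • (D f * Z * D g) := by
      simp only [map_sub, map_one, map_smul, hW, smul_add, mul_sub, sub_mul, one_mul, mul_one,
        smul_mul_assoc, mul_smul_comm, smul_sub, mul_smul]
      abel
    have h4 : ‖Z‖ ≤ ‖Z‖ * (1 - s * β) + s * ‖W‖ + s * s * ‖D f * Z * D g‖ := by
      calc ‖Z‖ = ‖D (1 - s • f) * Z * D (1 - s • g) + s • W - (s * s) • (D f * Z * D g)‖ := by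
              rw [← h3]
        _ ≤ ‖D (1 - s • f) * Z * D (1 - s • g)‖ + ‖s • W‖ + ‖(s * s) • (D f * Z * D g)‖ :=
              (norm_sub_le _ _).trans (by gcongr; exact norm_add_le _ _)
        _ ≤ _ := by
              rw [norm_smul, norm_smul, Real.norm_of_nonneg hs.le,
                Real.norm_of_nonneg (mul_pos hs hs).le]
              gcongr
              calc _ ≤ ‖D (1 - s • f)‖ * ‖Z‖ * ‖D (1 - s • g)‖ :=
                    (norm_mul_le _ _).trans (by gcongr; exact norm_mul_le _ _)
                _ ≤ 1 * ‖Z‖ * (1 - s * β) := by gcongr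
                _ = _ := by ring
    have h5 : s * (β * ‖Z‖) ≤ s * (‖W‖ + s * ‖D f * Z * D g‖) := by nlinarith
    exact le_of_mul_le_mul_left h5 hs
  have hlim : Filter.Tendsto (fun s : ℝ => ‖W‖ + s * ‖D f * Z * D g‖)
      (nhdsWithin 0 (Set.Ioi 0)) (nhds (‖W‖ + 0 * ‖D f * Z * D g‖)) := by
    apply Filter.Tendsto.mono_left _ nhdsWithin_le_nhds
    exact Continuous.tendsto (by fun_prop) 0
  rw [zero_mul, add_zero] at hlim
  refine ge_of_tendsto hlim ?_
  filter_upwards [Ioo_mem_nhdsGT (inv_pos.2 hM)] with s hs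
  exact key s hs.1 hs.2

lemma IsDiagonalRep.mul_norm_le' (hD : IsDiagonalRep D) {f g : ι → ℝ} {α M N : ℝ}
    (hf : ∀ i, α ≤ f i) (hfM : ∀ i, f i ≤ M) (hg : ∀ i, 0 ≤ g i) (hgM : ∀ i, g i ≤ N)
    (hα : 0 < α) (Z : E →L[ℂ] E) :
    α * ‖Z‖ ≤ ‖D f * Z + Z * D g‖ := by
  have h := hD.mul_norm_le (f := f - fun _ => α) (g := g + fun _ => α) (β := α)
    (M := max M (max N 0 + α)) (fun i => by simpa using hf i)
    (fun i => by
      have := hfM i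
      have h' := le_max_left M (max N 0 + α)
      simp only [Pi.sub_apply]; linarith)
    (fun i => by simpa using hg i)
    (fun i => by
      have := hgM i
      have h' := le_max_right M (max N 0 + α)
      have h'' := le_max_left N 0
      simp only [Pi.add_apply]; linarith)
    (lt_of_lt_of_le (by positivity) (le_max_right _ _))
    (le_trans (by simp) (le_max_right _ _)) Z
  refine h.trans_eq ?_
  have hc : D (fun _ => α) = α • (1 : E →L[ℂ] E) := by
    rw [← map_one D, ← map_smul]; congr 1; ext; simp
  rw [map_sub, map_add, hc]
  simp [sub_mul, mul_add]

/-- The indicator function of the set where `r` holds. -/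
noncomputable def ind (r : ι → Prop) : ι → ℝ := open Classical in fun i => if r i then 1 else 0

lemma ind_mul_self (r : ι → Prop) : ind r * ind r = ind r := by
  ext i; by_cases h : r i <;> simp [ind, h]

lemma IsDiagonalRep.norm_ind_le (hD : IsDiagonalRep D) (r : ι → Prop) : ‖D (ind r)‖ ≤ 1 :=
  hD.norm_le _ _ zero_le_one fun i => by by_cases h : r i <;> simp [ind, h]

lemma IsDiagonalRep.norm_one_sub_ind_le (hD : IsDiagonalRep D) (r : ι → Prop) :
    ‖D (1 - ind r)‖ ≤ 1 :=
  hD.norm_le _ _ zero_le_one fun i => by by_cases h : r i <;> simp [ind, h]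

lemma IsDiagonalRep.norm_blocks_le (hD : IsDiagonalRep D) {r t : ι → Prop} {U V : E →L[ℂ] E}
    {m : ℝ} (hU : ‖D (ind r) * U * D (ind t)‖ ≤ m)
    (hV : ‖D (1 - ind r) * V * D (1 - ind t)‖ ≤ m) :
    ‖D (ind r) * U * D (ind t) + D (1 - ind r) * V * D (1 - ind t)‖ ≤ m := by
  rw [map_sub, map_sub, map_one] at *
  exact norm_block_le (hD.star_eq _) (by rw [← map_mul, ind_mul_self]) (hD.star_eq _)
    (by rw [← map_mul, ind_mul_self]) hU hV

lemma IsDiagonalRep.norm_antiblocks_le (hD : IsDiagonalRep D) {r t : ι → Prop}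
    {U V : E →L[ℂ] E} {m : ℝ} (hU : ‖D (ind r) * U * D (1 - ind t)‖ ≤ m)
    (hV : ‖D (1 - ind r) * V * D (ind t)‖ ≤ m) :
    ‖D (ind r) * U * D (1 - ind t) + D (1 - ind r) * V * D (ind t)‖ ≤ m := by
  have ht : 1 - ind t = ind (fun i => ¬ t i) := by
    ext i; by_cases h : t i <;> simp [ind, h]
  have ht' : ind t = 1 - ind (fun i => ¬ t i) := by rw [← ht]; simp
  rw [ht] at hU ⊢
  rw [ht'] at hV ⊢
  exact hD.norm_blocks_le hU hV

theorem IsDiagonalRep.sylvester_bound (hD : IsDiagonalRep D) (k : ℕ) :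
    ∀ (f g : ι → ℝ) (Z : E →L[ℂ] E) (a M : ℝ), 0 < a → (∀ i, a ≤ f i) →
      (∀ i, f i ≤ a * 2 ^ (2 ^ k)) → (∀ i, 0 ≤ g i) → (∀ i, g i ≤ M) →
      ‖D f * Z‖ ≤ (2 + 2 * k) * ‖D f * Z + Z * D g‖ := by
  induction k with
  | zero =>
    intro f g Z a M ha hf hf' hg hg'
    have h1 := hD.mul_norm_le' hf hf' hg hg' ha Z
    have h2 : ‖D f‖ ≤ 2 * a := hD.norm_le _ _ (by positivity) fun i => by
      have := hf i; have := hf' i; rw [abs_of_nonneg (by linarith)]; norm_num at *; linarith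
    calc ‖D f * Z‖ ≤ ‖D f‖ * ‖Z‖ := norm_mul_le _ _
      _ ≤ 2 * a * ‖Z‖ := by gcongr
      _ ≤ (2 + 2 * (0 : ℕ)) * ‖D f * Z + Z * D g‖ := by push_cast; linarith
  | succ k ih =>
    intro f g Z a M ha hf hf' hg hg'
    set c := a * 2 ^ (2 ^ k) with hc
    have hac : a ≤ c := le_mul_of_one_le_right ha.le (one_le_pow₀ one_le_two)
    have hc0 : 0 < c := ha.trans_le hac
    have hcc : a * 2 ^ 2 ^ (k + 1) = c * 2 ^ 2 ^ k := by
      rw [hc, pow_succ 2 k, mul_comm (2 ^ k) 2, two_mul, pow_add]; ring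
    rw [hcc] at hf'
    have hccc : c ≤ c * 2 ^ 2 ^ k := le_mul_of_one_le_right hc0.le (one_le_pow₀ one_le_two)
    set Y := D f * Z + Z * D g with hY
    set p := ind fun i => f i ≤ c with hp
    set q := ind fun i => g i ≤ c with hq
    let fl : ι → ℝ := fun i => min (f i) c
    let fu : ι → ℝ := fun i => max (f i) c
    let gl : ι → ℝ := fun i => min (g i) c
    let gu : ι → ℝ := fun i => max (g i) c
    have hfl : f * p = fl * p := by
      ext i; by_cases h : f i ≤ c <;> simp [hp, ind, fl, h]
    have hfu : f * (1 - p) = fu * (1 - p) := by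
      ext i; by_cases h : f i ≤ c <;> simp [hp, ind, fu, h, (not_le.1 · |>.le)]
    have hgl : g * q = gl * q := by
      ext i; by_cases h : g i ≤ c <;> simp [hq, ind, gl, h]
    have hgu : g * (1 - q) = gu * (1 - q) := by
      ext i; by_cases h : g i ≤ c <;> simp [hq, ind, gu, h, (not_le.1 · |>.le)]
    have np : ‖D p‖ ≤ 1 := hD.norm_ind_le _
    have nq : ‖D q‖ ≤ 1 := hD.norm_ind_le _
    have np' : ‖D (1 - p)‖ ≤ 1 := hD.norm_one_sub_ind_le _
    have nq' : ‖D (1 - q)‖ ≤ 1 := hD.norm_one_sub_ind_le _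
    have b11 : ‖D p * (D f * Z) * D q‖ ≤ (2 + 2 * k) * ‖Y‖ := by
      rw [map_compress_mul q hfl]
      refine (ih fl g _ a M ha (fun i => le_min (hf i) hac) (fun i => min_le_right _ _) hg
        hg').trans ?_
      rw [sylvester_compress hfl rfl]
      gcongr
      exact norm_compress_le _ _ _ np nq
    have b22 : ‖D (1 - p) * (D f * Z) * D (1 - q)‖ ≤ (2 + 2 * k) * ‖Y‖ := by
      rw [map_compress_mul _ hfu]
      refine (ih fu g _ c M hc0 (fun i => le_max_right _ _) (fun i => max_le (hf' i) hccc) hg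
        hg').trans ?_
      rw [sylvester_compress hfu rfl]
      gcongr
      exact norm_compress_le _ _ _ np' nq'
    have b12 : ‖D p * (D f * Z) * D (1 - q)‖ ≤ 2 * ‖Y‖ := by
      rw [map_compress_mul _ hfl]
      have h1 := hD.mul_norm_le (f := fl) (g := gu) (β := c) (M := max M c)
        (fun i => le_min (ha.le.trans (hf i)) hc0.le)
        (fun i => (min_le_right _ _).trans (le_max_right _ _)) (fun i => le_max_right _ _)
        (fun i => max_le_max (hg' i) le_rfl) (lt_max_of_lt_right hc0) (le_max_right _ _)
        (D p * Z * D (1 - q))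
      rw [sylvester_compress hfl hgu] at h1
      have h2 := h1.trans (norm_compress_le _ _ _ np nq')
      have h3 : ‖D fl‖ ≤ c := hD.norm_le _ _ hc0.le fun i => by
        rw [abs_of_nonneg (le_min (ha.le.trans (hf i)) hc0.le)]; exact min_le_right _ _
      calc _ ≤ ‖D fl‖ * ‖D p * Z * D (1 - q)‖ := norm_mul_le _ _
        _ ≤ c * ‖D p * Z * D (1 - q)‖ := by gcongr
        _ ≤ ‖Y‖ := h2
        _ ≤ 2 * ‖Y‖ := by linarith [norm_nonneg Y]
    have b21 : ‖D (1 - p) * (D f * Z) * D q‖ ≤ 2 * ‖Y‖ := by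
      have h1 := hD.mul_norm_le' (f := fu) (g := gl) (α := c) (M := c * 2 ^ 2 ^ k) (N := c)
        (fun i => le_max_right _ _) (fun i => max_le (hf' i) hccc)
        (fun i => le_min (hg i) hc0.le) (fun i => min_le_right _ _) hc0
        (D (1 - p) * Z * D q)
      rw [sylvester_compress hfu hgl] at h1
      have h2 := h1.trans (norm_compress_le _ _ _ np' nq)
      have h3 : ‖D gl‖ ≤ c := hD.norm_le _ _ hc0.le fun i => by
        rw [abs_of_nonneg (le_min (hg i) hc0.le)]; exact min_le_right _ _
      have h4 : ‖D (1 - p) * (Z * D g) * D q‖ ≤ ‖Y‖ := by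
        rw [mul_map_compress _ hgl]
        calc _ ≤ ‖D (1 - p) * Z * D q‖ * ‖D gl‖ := norm_mul_le _ _
          _ ≤ ‖D (1 - p) * Z * D q‖ * c := by gcongr
          _ ≤ ‖Y‖ := by linarith
      have h5 : D (1 - p) * (D f * Z) * D q
          = D (1 - p) * Y * D q - D (1 - p) * (Z * D g) * D q := by
        rw [hY, mul_add, add_mul, add_sub_cancel_right]
      rw [h5]
      calc _ ≤ ‖D (1 - p) * Y * D q‖ + ‖D (1 - p) * (Z * D g) * D q‖ := norm_sub_le _ _
        _ ≤ ‖Y‖ + ‖Y‖ := by gcongr; exact norm_compress_le _ _ _ np' nq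
        _ = 2 * ‖Y‖ := by ring
    rw [eq_sum_blocks p q (D f * Z)]
    calc _ ≤ (2 + 2 * k) * ‖Y‖ + 2 * ‖Y‖ :=
          (norm_add_le _ _).trans (add_le_add (hD.norm_blocks_le b11 b22)
            (hD.norm_antiblocks_le b12 b21))
      _ = (2 + 2 * (k + 1 : ℕ)) * ‖Y‖ := by push_cast; ring

theorem IsDiagonalRep.abs_commutator_bound (hD : IsDiagonalRep D) (k : ℕ) {l : ι → ℝ}
    {a b M : ℝ} (ha : 0 < a) (hb : b ≤ a * 2 ^ (2 ^ k)) (hl : ∀ i, l i ∈ Set.Iic 0 ∪ Set.Icc a b)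
    (hM : ∀ i, |l i| ≤ M) (Z : E →L[ℂ] E) :
    ‖D |l| * Z - Z * D |l|‖ ≤ (6 + 4 * k) * ‖D l * Z - Z * D l‖ := by
  set Y := D l * Z - Z * D l with hY
  set T := D |l| * Z - Z * D |l| with hT
  set p := ind fun i => 0 < l i with hp
  let f : ι → ℝ := fun i => max (l i) a
  let g : ι → ℝ := fun i => max (-l i) 0
  have hla : ∀ i, 0 < l i → a ≤ l i ∧ l i ≤ b := fun i hi => by
    rcases hl i with h | h
    · exact absurd hi (not_lt.2 h)
    · exact h
  have hfp : l * p = f * p := by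
    ext i; by_cases h : 0 < l i
    · simp [hp, ind, f, h, (hla i h).1]
    · simp [hp, ind, h]
  have hgp : -l * (1 - p) = g * (1 - p) := by
    ext i; by_cases h : 0 < l i
    · simp [hp, ind, h]
    · simp [hp, ind, g, h, not_lt.1 h]
  have hlp : |l| * p = l * p := by
    ext i; by_cases h : 0 < l i
    · simp [hp, ind, h, abs_of_pos h]
    · simp [hp, ind, h]
  have hln : |l| * (1 - p) = -l * (1 - p) := by
    ext i; by_cases h : 0 < l i
    · simp [hp, ind, h]
    · simp [hp, ind, h, abs_of_nonpos (not_lt.1 h)]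
  have hf1 : ∀ i, a ≤ f i := fun i => le_max_right _ _
  have hf2 : ∀ i, f i ≤ a * 2 ^ (2 ^ k) := fun i => by
    have h1 : a ≤ a * 2 ^ (2 ^ k) := le_mul_of_one_le_right ha.le (one_le_pow₀ one_le_two)
    rcases hl i with h | h
    · exact max_le (le_trans (le_trans h ha.le) h1) h1
    · exact max_le (h.2.trans hb) h1
  have hg1 : ∀ i, 0 ≤ g i := fun i => le_max_right _ _
  have hg2 : ∀ i, g i ≤ M := fun i =>
    max_le ((neg_le_abs _).trans (hM i)) ((abs_nonneg _).trans (hM i))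
  have np : ‖D p‖ ≤ 1 := hD.norm_ind_le _
  have np' : ‖D (1 - p)‖ ≤ 1 := hD.norm_one_sub_ind_le _
  have b11 : ‖D p * T * D p‖ ≤ ‖Y‖ := by
    have : D p * T * D p = D p * Y * D p := by
      simp only [hT, hY, mul_sub, sub_mul]
      rw [map_compress_mul p hlp, mul_map_compress p hlp,
        map_compress_mul p (rfl : l * p = l * p), mul_map_compress p (rfl : l * p = l * p)]
    rw [this]; exact norm_compress_le _ _ _ np np
  have b22 : ‖D (1 - p) * T * D (1 - p)‖ ≤ ‖Y‖ := by
    have : D (1 - p) * T * D (1 - p) = -(D (1 - p) * Y * D (1 - p)) := by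
      simp only [hT, hY, mul_sub, sub_mul]
      rw [map_compress_mul _ hln, mul_map_compress _ hln,
        map_compress_mul _ (rfl : l * (1 - p) = l * (1 - p)),
        mul_map_compress _ (rfl : l * (1 - p) = l * (1 - p)), map_neg]
      simp only [neg_mul, mul_neg]; abel
    rw [this, norm_neg]; exact norm_compress_le _ _ _ np' np'
  have b12 : ‖D p * T * D (1 - p)‖ ≤ (5 + 4 * k) * ‖Y‖ := by
    have h1 : D p * Y * D (1 - p)
        = D f * (D p * Z * D (1 - p)) + D p * Z * D (1 - p) * D g := by
      rw [sylvester_compress hfp hgp, hY, map_neg, mul_neg, sub_eq_add_neg]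
    have h2 : D p * T * D (1 - p)
        = (2 : ℝ) • (D f * (D p * Z * D (1 - p))) - D p * Y * D (1 - p) := by
      rw [h1, hT, mul_sub, sub_mul, map_compress_mul _ (hlp.trans hfp),
        mul_map_compress _ (hln.trans hgp), two_smul]
      abel
    have h3 := hD.sylvester_bound k f g (D p * Z * D (1 - p)) a M ha hf1 hf2 hg1 hg2
    rw [← h1] at h3
    have h4 : ‖D p * Y * D (1 - p)‖ ≤ ‖Y‖ := norm_compress_le _ _ _ np np'
    rw [h2]
    calc _ ≤ 2 * ‖D f * (D p * Z * D (1 - p))‖ + ‖D p * Y * D (1 - p)‖ := by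
          refine (norm_sub_le _ _).trans ?_
          rw [norm_smul]; norm_num
      _ ≤ 2 * ((2 + 2 * k) * ‖D p * Y * D (1 - p)‖) + ‖D p * Y * D (1 - p)‖ := by gcongr
      _ = (5 + 4 * k) * ‖D p * Y * D (1 - p)‖ := by ring
      _ ≤ _ := by gcongr
  have b21 : ‖D (1 - p) * T * D p‖ ≤ (5 + 4 * k) * ‖Y‖ := by
    have h1 : -(D (1 - p) * Y * D p)
        = D g * (D (1 - p) * Z * D p) + D (1 - p) * Z * D p * D f := by
      rw [sylvester_compress hgp hfp, hY, map_neg]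
      noncomm_ring
    have h2 : D (1 - p) * T * D p
        = -(D (1 - p) * Y * D p) - (2 : ℝ) • (D (1 - p) * Z * D p * D f) := by
      rw [h1, hT, mul_sub, sub_mul, map_compress_mul _ (hln.trans hgp),
        mul_map_compress _ (hlp.trans hfp), two_smul]
      abel
    have h3 := hD.sylvester_bound k f g (star (D (1 - p) * Z * D p)) a M ha hf1 hf2 hg1 hg2
    have h5 : D f * star (D (1 - p) * Z * D p) = star (D (1 - p) * Z * D p * D f) := by
      rw [star_mul _ (D f), hD.star_eq]
    have h6 : star (D (1 - p) * Z * D p) * D g = star (D g * (D (1 - p) * Z * D p)) := by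
      rw [star_mul _ (D (1 - p) * Z * D p), hD.star_eq]
    rw [h5, h6, ← star_add, add_comm (D (1 - p) * Z * D p * D f), ← h1, norm_star, norm_star,
      norm_neg] at h3
    have h4 : ‖D (1 - p) * Y * D p‖ ≤ ‖Y‖ := norm_compress_le _ _ _ np' np
    rw [h2]
    calc _ ≤ ‖D (1 - p) * Y * D p‖ + 2 * ‖D (1 - p) * Z * D p * D f‖ := by
          refine (norm_sub_le _ _).trans ?_
          rw [norm_smul, norm_neg]; norm_num
      _ ≤ ‖D (1 - p) * Y * D p‖ + 2 * ((2 + 2 * k) * ‖D (1 - p) * Y * D p‖) := by gcongr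
      _ = (5 + 4 * k) * ‖D (1 - p) * Y * D p‖ := by ring
      _ ≤ _ := by gcongr
  rw [eq_sum_blocks p p T]
  calc _ ≤ ‖Y‖ + (5 + 4 * k) * ‖Y‖ :=
        (norm_add_le _ _).trans (add_le_add (hD.norm_blocks_le b11 b22)
          (hD.norm_antiblocks_le b12 b21))
    _ = (6 + 4 * k) * ‖Y‖ := by ring

end DiagonalMultipliers

section Dilation

variable {ι : Type*} [Fintype ι] {H : Type*} [NormedAddCommGroup H] [InnerProductSpace ℂ H]

/-- The operator `(hᵢ)ᵢ ↦ (f i • hᵢ)ᵢ` on a finite Hilbert sum, as a function of `f`. -/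
noncomputable def diagOp (ι : Type*) [Fintype ι] (H : Type*) [NormedAddCommGroup H]
    [InnerProductSpace ℂ H] :
    (ι → ℝ) →ₐ[ℝ] (PiLp 2 (fun _ : ι => H) →L[ℂ] PiLp 2 (fun _ : ι => H)) :=
  AlgHom.ofLinearMap
    { toFun := fun f => (PiLp.continuousLinearEquiv 2 ℂ (fun _ : ι => H)).symm ∘L
        (ContinuousLinearMap.pi fun i => (f i : ℂ) • PiLp.proj 2 (fun _ : ι => H) i)
      map_add' := fun f g => by ext x i; simp [add_smul]
      map_smul' := fun c f => by ext x i; simp [mul_smul] }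
    (by ext x i; simp)
    (fun f g => by ext x i; simp [mul_smul])

@[simp]
lemma diagOp_apply (f : ι → ℝ) (x : PiLp 2 (fun _ : ι => H)) (i : ι) :
    diagOp ι H f x i = (f i : ℂ) • x i := rfl

lemma isDiagonalRep_diagOp [CompleteSpace H] : IsDiagonalRep (diagOp ι H) where
  star_eq f := by
    rw [ContinuousLinearMap.star_eq_adjoint, eq_comm, ContinuousLinearMap.eq_adjoint_iff]
    intro x y
    simp only [PiLp.inner_apply, diagOp_apply, inner_smul_left, inner_smul_right,
      Complex.conj_ofReal]
  norm_le f c hc hf := by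
    refine ContinuousLinearMap.opNorm_le_bound _ hc fun x => ?_
    refine (pow_le_pow_iff_left₀ (norm_nonneg _) (by positivity) two_ne_zero).1 ?_
    rw [mul_pow, PiLp.norm_sq_eq_of_L2, PiLp.norm_sq_eq_of_L2, Finset.mul_sum]
    refine Finset.sum_le_sum fun i _ => ?_
    rw [diagOp_apply, norm_smul, mul_pow, Complex.norm_real]
    gcongr
    exact hf i

variable [CompleteSpace H]

lemma sum_norm_sq_cfc_eq (A : H →L[ℂ] H) (s : ι → ℝ → ℝ)
    (hs : ∀ i, ContinuousOn (s i) (spectrum ℝ A)) (_hA : IsSelfAdjoint A) (h : H) :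
    ((∑ i, ‖cfc (s i) A h‖ ^ 2 : ℝ) : ℂ) =
      inner ℂ h (cfc (fun x => ∑ i, s i x ^ 2) A h) := by
  have h1 : cfc (fun x => ∑ i, s i x ^ 2) A = ∑ i, cfc (s i) A * cfc (s i) A := by
    have := cfc_sum_univ (fun i x => s i x ^ 2) A (fun i => (hs i).pow 2)
    have h2 : (∑ i, fun x => s i x ^ 2) = fun x => ∑ i, s i x ^ 2 := by ext; simp
    rw [h2] at this
    rw [this]
    refine Finset.sum_congr rfl fun i _ => ?_
    rw [← cfc_mul (s i) (s i) A (hs i) (hs i)]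
    simp [pow_two]
  rw [h1, sum_apply, inner_sum]
  push_cast
  refine Finset.sum_congr rfl fun i _ => ?_
  have h3 : star (cfc (s i) A) = cfc (s i) A := cfc_predicate (s i) A
  have h4 : ∀ C : H →L[ℂ] H, star C = C → inner ℂ h (C (C h)) = (‖C h‖ : ℂ) ^ 2 := by
    intro C hC
    have h5 := ContinuousLinearMap.adjoint_inner_right C h (C h)
    rw [← ContinuousLinearMap.star_eq_adjoint, hC] at h5
    rw [h5, inner_self_eq_norm_sq_to_K]
    rfl
  exact (h4 _ h3).symm

lemma sum_norm_sq_cfc_le (A : H →L[ℂ] H) (s : ι → ℝ → ℝ)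
    (hs : ∀ i, ContinuousOn (s i) (spectrum ℝ A)) (hA : IsSelfAdjoint A) {c : ℝ}
    (hc : ∀ x ∈ spectrum ℝ A, ∑ i, s i x ^ 2 ≤ c) (h : H) :
    ∑ i, ‖cfc (s i) A h‖ ^ 2 ≤ c * ‖h‖ ^ 2 := by
  have h1 : cfc (fun x => ∑ i, s i x ^ 2) A ≤ algebraMap ℝ (H →L[ℂ] H) c := by
    rw [← cfc_const c A]
    exact cfc_mono hc (continuousOn_finsetSum _ fun i _ => (hs i).pow 2) continuousOn_const
  rw [ContinuousLinearMap.le_def] at h1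
  have h2 := h1.re_inner_nonneg_right h
  rw [sub_apply, inner_sub_right, ← sum_norm_sq_cfc_eq A s hs hA] at h2
  have h3 : (algebraMap ℝ (H →L[ℂ] H) c) h = (c : ℂ) • h := by
    rw [Algebra.algebraMap_eq_smul_one]; rfl
  rw [h3, inner_smul_right, inner_self_eq_norm_sq_to_K] at h2
  rw [map_sub] at h2
  have h4 : RCLike.re (((c : ℂ) * ((‖h‖ : ℂ)) ^ 2)) = c * ‖h‖ ^ 2 := by
    rw [← Complex.ofReal_pow, ← Complex.ofReal_mul]; exact Complex.ofReal_re _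
  have h5 : RCLike.re ((∑ i, ‖cfc (s i) A h‖ ^ 2 : ℝ) : ℂ) = ∑ i, ‖cfc (s i) A h‖ ^ 2 :=
    Complex.ofReal_re _
  rw [h5] at h2
  have h6 := h4 ▸ h2
  linarith

lemma sum_norm_sq_cfc_of_eq_one (A : H →L[ℂ] H) (s : ι → ℝ → ℝ)
    (hs : ∀ i, ContinuousOn (s i) (spectrum ℝ A)) (hA : IsSelfAdjoint A)
    (h1 : ∀ x ∈ spectrum ℝ A, ∑ i, s i x ^ 2 = 1) (h : H) :
    ∑ i, ‖cfc (s i) A h‖ ^ 2 = ‖h‖ ^ 2 := by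
  have h2 := sum_norm_sq_cfc_eq A s hs hA h
  rw [cfc_congr (g := fun _ => (1 : ℝ)) (fun x hx => h1 x hx), cfc_const_one ℝ A,
    one_apply_eq_self, inner_self_eq_norm_sq_to_K] at h2
  refine Complex.ofReal_injective (h2.trans ?_)
  rw [Complex.ofReal_pow]
  rfl

/-- A self-adjoint operator is approximately intertwined, by an isometry, with a diagonal operator
whose entries form a net of its spectrum. -/
lemma exists_isometry_diagOp (A : H →L[ℂ] H) (hA : IsSelfAdjoint A) (t : Finset ℝ) {δ : ℝ}
    (hδ : 0 < δ) (ht : spectrum ℝ A ⊆ ⋃ x ∈ t, Metric.ball x δ) :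
    ∃ V : H →L[ℂ] PiLp 2 (fun _ : t => H), (∀ h, ‖V h‖ = ‖h‖) ∧
      ∀ φ : ℝ → ℝ, LipschitzWith 1 φ →
        ‖diagOp t H (fun i => φ i) ∘L V - V ∘L cfc φ A‖ ≤ δ := by
  let w : t → ℝ → ℝ := fun i x => max 0 (δ - |x - i|)
  have hw : ∀ i, Continuous (w i) := fun i => by fun_prop
  have hw0 : ∀ i x, 0 ≤ w i x := fun i x => le_max_left _ _
  let S : ℝ → ℝ := fun x => ∑ i, w i x
  have hSc : Continuous S := by fun_prop
  have hS : ∀ x ∈ spectrum ℝ A, 0 < S x := by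
    intro x hx
    obtain ⟨y, hy, hxy⟩ := Set.mem_iUnion₂.1 (ht hx)
    refine Finset.sum_pos' (fun i _ => hw0 i x) ⟨⟨y, hy⟩, Finset.mem_univ _, ?_⟩
    refine lt_max_of_lt_right ?_
    rw [Metric.mem_ball, Real.dist_eq] at hxy
    simpa using hxy
  let r : t → ℝ → ℝ := fun i x => √(w i x / S x)
  have hr : ∀ i, ContinuousOn (r i) (spectrum ℝ A) := fun i =>
    ((hw i).continuousOn.div hSc.continuousOn fun x hx => (hS x hx).ne').sqrt
  have hr2 : ∀ i, ∀ x ∈ spectrum ℝ A, r i x ^ 2 = w i x / S x := fun i x hx =>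
    Real.sq_sqrt (div_nonneg (hw0 i x) (hS x hx).le)
  have hsum : ∀ x ∈ spectrum ℝ A, ∑ i, r i x ^ 2 = 1 := fun x hx => by
    rw [Finset.sum_congr rfl fun i _ => hr2 i x hx, ← Finset.sum_div]
    exact div_self (hS x hx).ne'
  refine ⟨(PiLp.continuousLinearEquiv 2 ℂ (fun _ : t => H)).symm ∘L
        (ContinuousLinearMap.pi fun i => cfc (r i) A), fun h => ?_, fun φ hφ => ?_⟩
  · refine (pow_left_inj₀ (norm_nonneg _) (norm_nonneg _) two_ne_zero).1 ?_
    rw [PiLp.norm_sq_eq_of_L2, ← sum_norm_sq_cfc_of_eq_one A r hr hA hsum]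
    rfl
  · have hφc : ∀ i : t, ContinuousOn (fun x => φ i - φ x) (spectrum ℝ A) := fun i =>
      (continuous_const.sub hφ.continuous).continuousOn
    refine ContinuousLinearMap.opNorm_le_bound _ hδ.le fun h => ?_
    refine (pow_le_pow_iff_left₀ (norm_nonneg _) (by positivity) two_ne_zero).1 ?_
    rw [mul_pow]
    refine le_trans (le_of_eq ?_) (sum_norm_sq_cfc_le A (fun (i : t) x => (φ i - φ x) * r i x)
      (fun i => (hφc i).mul (hr i)) hA (c := δ ^ 2) (fun x hx => ?_) h)
    · rw [PiLp.norm_sq_eq_of_L2]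
      refine Finset.sum_congr rfl fun i _ => ?_
      congr 2
      have e1 : cfc (fun x => (φ i - φ x) * r i x) A
          = algebraMap ℝ _ (φ i) * cfc (r i) A - cfc (r i) A * cfc φ A := by
        have hc : (fun x => (φ i - φ x) * r i x) = fun x => φ i * r i x - r i x * φ x := by
          ext; ring
        rw [hc, cfc_sub (fun x => φ i * r i x) (fun x => r i x * φ x) A
            (continuousOn_const.mul (hr i)) ((hr i).mul hφ.continuous.continuousOn),
          cfc_const_mul (φ i) (r i) A (hr i), cfc_mul (r i) φ A (hr i)
            hφ.continuous.continuousOn, Algebra.algebraMap_eq_smul_one, smul_mul_assoc, one_mul]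
      rw [e1, Algebra.algebraMap_eq_smul_one]
      rfl
    · calc ∑ i : t, ((φ i - φ x) * r i x) ^ 2 ≤ ∑ i : t, δ ^ 2 * r i x ^ 2 := by
            refine Finset.sum_le_sum fun i _ => ?_
            rw [mul_pow]
            by_cases hi : |x - i| < δ
            · gcongr ?_ * _
              refine sq_le_sq' ?_ ?_
              all_goals
                have := abs_le.1 (hφ.dist_le_mul i x)
                rw [dist_comm, Real.dist_eq] at this
                simp only [NNReal.coe_one, one_mul] at this
              · linarith
              · linarith
            · have : w i x = 0 := max_eq_left (by linarith [not_lt.1 hi])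
              rw [hr2 i x hx, this]; simp
        _ = δ ^ 2 := by rw [← Finset.mul_sum, hsum x hx, mul_one]

end Dilation

section UpperBound

lemma norm_adjoint_le_one {E F : Type*} [NormedAddCommGroup E] [InnerProductSpace ℂ E]
    [CompleteSpace E] [NormedAddCommGroup F] [InnerProductSpace ℂ F] [CompleteSpace F]
    {V : E →L[ℂ] F} (hV : ‖V‖ ≤ 1) : ‖V.adjoint‖ ≤ 1 := by
  rwa [LinearIsometryEquiv.norm_map]

lemma norm_le_one_of_isometry {E F : Type*} [NormedAddCommGroup E] [InnerProductSpace ℂ E]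
    [NormedAddCommGroup F] [InnerProductSpace ℂ F]
    {V : E →L[ℂ] F} (hV : ∀ h, ‖V h‖ = ‖h‖) : ‖V‖ ≤ 1 :=
  ContinuousLinearMap.opNorm_le_bound _ zero_le_one fun h => by rw [hV, one_mul]

lemma norm_conj_le {E F : Type*} [NormedAddCommGroup E] [InnerProductSpace ℂ E]
    [NormedAddCommGroup F] [InnerProductSpace ℂ F]
    {V : E →L[ℂ] F} {W : F →L[ℂ] E} (hV : ‖V‖ ≤ 1) (hW : ‖W‖ ≤ 1) (T : E →L[ℂ] E) :
    ‖V ∘L T ∘L W‖ ≤ ‖T‖ := by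
  calc ‖V ∘L T ∘L W‖ ≤ ‖V‖ * (‖T‖ * ‖W‖) :=
        (ContinuousLinearMap.opNorm_comp_le _ _).trans
          (by gcongr; exact ContinuousLinearMap.opNorm_comp_le _ _)
    _ ≤ 1 * (‖T‖ * 1) := by gcongr
    _ = ‖T‖ := by ring

lemma norm_conj_isometry {E F : Type*} [NormedAddCommGroup E] [InnerProductSpace ℂ E]
    [CompleteSpace E] [NormedAddCommGroup F] [InnerProductSpace ℂ F] [CompleteSpace F]
    {V W : E →L[ℂ] F} (hV : ∀ h, ‖V h‖ = ‖h‖) (hW : ∀ h, ‖W h‖ = ‖h‖) (T : E →L[ℂ] E) :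
    ‖V ∘L T ∘L W.adjoint‖ = ‖T‖ := by
  have nV := norm_le_one_of_isometry hV
  have nW := norm_le_one_of_isometry hW
  refine le_antisymm (norm_conj_le nV (norm_adjoint_le_one nW) T) ?_
  have h1 : T = V.adjoint ∘L (V ∘L T ∘L W.adjoint) ∘L W := by
    have h2 := V.norm_map_iff_adjoint_comp_self.1 hV
    have h3 := W.norm_map_iff_adjoint_comp_self.1 hW
    calc T = (V.adjoint ∘L V) ∘L T ∘L (W.adjoint ∘L W) := by rw [h2, h3]; rfl
      _ = _ := rfl
  calc ‖T‖ = ‖V.adjoint ∘L (V ∘L T ∘L W.adjoint) ∘L W‖ := by rw [← h1]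
    _ ≤ _ := by
      calc _ ≤ ‖V.adjoint‖ * (‖V ∘L T ∘L W.adjoint‖ * ‖W‖) :=
            (ContinuousLinearMap.opNorm_comp_le _ _).trans
              (by gcongr; exact ContinuousLinearMap.opNorm_comp_le _ _)
        _ ≤ 1 * (‖V ∘L T ∘L W.adjoint‖ * 1) := by
              gcongr
              exact norm_adjoint_le_one nV
        _ = _ := by ring

lemma norm_commutator_sub_conj_le {E F : Type*} [NormedAddCommGroup E] [InnerProductSpace ℂ E]
    [CompleteSpace E] [NormedAddCommGroup F] [InnerProductSpace ℂ F] [CompleteSpace F]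
    {V W : E →L[ℂ] F} (hV : ∀ h, ‖V h‖ = ‖h‖) (hW : ∀ h, ‖W h‖ = ‖h‖) {X Y : E →L[ℂ] E}
    (hY : star Y = Y) {L : F →L[ℂ] F} (hL : star L = L) {δ : ℝ}
    (h1 : ‖L ∘L V - V ∘L X‖ ≤ δ) (h2 : ‖L ∘L W - W ∘L Y‖ ≤ δ) :
    ‖(L * (V ∘L W.adjoint) - (V ∘L W.adjoint) * L) - V ∘L (X - Y) ∘L W.adjoint‖ ≤ 2 * δ := by
  have nV := norm_le_one_of_isometry hV
  have nW := norm_adjoint_le_one (norm_le_one_of_isometry hW)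
  have h3 : ‖W.adjoint ∘L L - Y ∘L W.adjoint‖ ≤ δ := by
    rw [ContinuousLinearMap.star_eq_adjoint] at hY hL
    rw [← LinearIsometryEquiv.norm_map ContinuousLinearMap.adjoint, map_sub,
      ContinuousLinearMap.adjoint_comp, ContinuousLinearMap.adjoint_comp, hY, hL] at h2
    exact h2
  have h4 : (L * (V ∘L W.adjoint) - (V ∘L W.adjoint) * L) - V ∘L (X - Y) ∘L W.adjoint
      = (L ∘L V - V ∘L X) ∘L W.adjoint - V ∘L (W.adjoint ∘L L - Y ∘L W.adjoint) := by
    ext x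
    simp only [ContinuousLinearMap.comp_apply, sub_apply, mul_apply_eq_comp, map_sub]
    abel
  have hδ : 0 ≤ δ := (norm_nonneg _).trans h1
  rw [h4]
  calc _ ≤ ‖L ∘L V - V ∘L X‖ * ‖W.adjoint‖ + ‖V‖ * ‖W.adjoint ∘L L - Y ∘L W.adjoint‖ :=
        (norm_sub_le _ _).trans (add_le_add (ContinuousLinearMap.opNorm_comp_le _ _)
          (ContinuousLinearMap.opNorm_comp_le _ _))
    _ ≤ δ * 1 + 1 * δ := by gcongr
    _ = 2 * δ := by ring

variable {H : Type} [NormedAddCommGroup H] [InnerProductSpace ℂ H] [CompleteSpace H]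

lemma opAbs_eq_cfc_abs {T : H →L[ℂ] H} (hT : IsSelfAdjoint T) :
    opAbs T = cfc (fun x : ℝ => |x|) T := by
  have h1 : star T * T = cfc (fun x : ℝ => x ^ 2) T := by
    rw [cfc_pow_id T 2, hT.star_eq, pow_two]
  rw [opAbs, h1, ← cfc_comp' Real.sqrt (fun x : ℝ => x ^ 2) T]
  simp only [Real.sqrt_sq_eq_abs]

theorem norm_opAbs_sub_le {A B : H →L[ℂ] H} (hA : IsSelfAdjoint A) (hB : IsSelfAdjoint B)
    {a b : ℝ} (ha : 0 < a) {k : ℕ} (hb : b ≤ a * 2 ^ (2 ^ k))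
    (hsA : spectrum ℝ A ⊆ Set.Iic 0 ∪ Set.Icc a b) (hsB : spectrum ℝ B ⊆ Set.Iic 0 ∪ Set.Icc a b) :
    ‖opAbs A - opAbs B‖ ≤ (6 + 4 * k) * ‖A - B‖ := by
  set C : ℝ := 6 + 4 * k with hC
  have hC0 : 0 ≤ C := by positivity
  have key : ∀ δ : ℝ, 0 < δ → ‖opAbs A - opAbs B‖ ≤ C * ‖A - B‖ + (2 * C + 2) * δ := by
    intro δ hδ
    have hK : IsCompact (spectrum ℝ A ∪ spectrum ℝ B) :=
      (spectrum.isCompact A).union (spectrum.isCompact B)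
    obtain ⟨t, htK, htf, htc⟩ := hK.finite_cover_balls hδ
    lift t to Finset ℝ using htf
    have hcov : spectrum ℝ A ∪ spectrum ℝ B ⊆ ⋃ x ∈ t, Metric.ball x δ := htc
    obtain ⟨V, hV, hVφ⟩ := exists_isometry_diagOp A hA t hδ
      (Set.subset_union_left.trans hcov)
    obtain ⟨W, hW, hWφ⟩ := exists_isometry_diagOp B hB t hδ
      (Set.subset_union_right.trans hcov)
    have hlipabs : LipschitzWith 1 (fun x : ℝ => |x|) :=
      LipschitzWith.mk_one fun x y => abs_abs_sub_abs_le x y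
    have hD : IsDiagonalRep (diagOp t H) := isDiagonalRep_diagOp
    have e1 := norm_commutator_sub_conj_le hV hW
      (cfc_predicate (fun x : ℝ => |x|) B : IsSelfAdjoint _) (hD.star_eq _)
      (hVφ _ hlipabs) (hWφ _ hlipabs)
    have hA1 := hVφ id LipschitzWith.id
    have hB1 := hWφ id LipschitzWith.id
    rw [cfc_id ℝ A] at hA1
    rw [cfc_id ℝ B] at hB1
    have e2 := norm_commutator_sub_conj_le hV hW hB (hD.star_eq _)
      hA1 hB1
    rw [← opAbs_eq_cfc_abs hA, ← opAbs_eq_cfc_abs hB] at e1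
    have hl : ∀ i : t, (i : ℝ) ∈ Set.Iic 0 ∪ Set.Icc a b := fun i =>
      Set.union_subset hsA hsB (htK i.2)
    obtain ⟨M, hM⟩ : ∃ M : ℝ, ∀ i : t, |(i : ℝ)| ≤ M :=
      ⟨∑ j : t, |(j : ℝ)|, fun i =>
        Finset.single_le_sum (f := fun j : t => |(j : ℝ)|) (fun _ _ => abs_nonneg _)
          (Finset.mem_univ i)⟩
    have e3 := hD.abs_commutator_bound k (l := fun i : t => (i : ℝ)) ha hb hl hM
      (V ∘L W.adjoint)
    have n1 := norm_conj_isometry hV hW (opAbs A - opAbs B)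
    have n2 := norm_conj_isometry hV hW (A - B)
    rw [← n1, ← n2]
    set T := diagOp t H |fun i : t => (i : ℝ)| * (V ∘L W.adjoint)
      - (V ∘L W.adjoint) * diagOp t H |fun i : t => (i : ℝ)|
    set Y := diagOp t H (fun i : t => (i : ℝ)) * (V ∘L W.adjoint)
      - (V ∘L W.adjoint) * diagOp t H (fun i : t => (i : ℝ))
    have e1' : ‖V ∘L (opAbs A - opAbs B) ∘L W.adjoint‖ ≤ ‖T‖ + 2 * δ :=
      (norm_le_norm_add_norm_sub' _ T).trans
        (by gcongr; exact (norm_sub_rev _ _).trans_le e1)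
    have e2' : ‖Y‖ ≤ ‖V ∘L (A - B) ∘L W.adjoint‖ + 2 * δ :=
      (norm_le_norm_add_norm_sub' _ _).trans (by gcongr; exact e2)
    calc _ ≤ ‖T‖ + 2 * δ := e1'
      _ ≤ C * (‖V ∘L (A - B) ∘L W.adjoint‖ + 2 * δ) + 2 * δ := by
          gcongr; exact e3.trans (by gcongr)
      _ = _ := by ring
  refine le_of_forall_pos_le_add fun ε hε => ?_
  have h := key (ε / (2 * C + 2)) (by positivity)
  rwa [mul_div_cancel₀ _ (by positivity)] at h

/-- The scale count `k` with `b ≤ a * 2 ^ (2 ^ k)` is at most of order `log (2 + log (b / a))`. -/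
lemma exists_scale {a b : ℝ} (ha : 0 < a) (hab : a < b) :
    ∃ k : ℕ, b ≤ a * 2 ^ (2 ^ k) ∧ (6 + 4 * k : ℝ) ≤ 30 * Real.log (2 + Real.log (b / a)) := by
  have hL : 0 < Real.log (b / a) := Real.log_pos ((one_lt_div ha).2 hab)
  set L := Real.log (b / a) with hLdef
  have hlog2 : 0.6931471803 < Real.log 2 := Real.log_two_gt_d9
  have hlog2' : 0 < Real.log 2 := by linarith
  have hlL : Real.log 2 ≤ Real.log (2 + L) := Real.log_le_log (by norm_num) (by linarith)
  refine ⟨⌈Real.log (2 + L) / Real.log 2⌉₊ + 1, ?_, ?_⟩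
  · set k := ⌈Real.log (2 + L) / Real.log 2⌉₊ with hk
    have h1 : Real.log (2 + L) / Real.log 2 ≤ k := Nat.le_ceil _
    rw [div_le_iff₀ hlog2', ← Real.log_pow] at h1
    have h2 : 2 + L ≤ 2 ^ k := (Real.log_le_log_iff (by linarith) (by positivity)).1 h1
    have h3 : b / a ≤ 2 ^ (2 ^ (k + 1)) := by
      rw [← Real.log_le_log_iff (div_pos (ha.trans hab) ha) (by positivity), Real.log_pow]
      push_cast
      rw [pow_succ]
      nlinarith
    rw [div_le_iff₀ ha] at h3
    linarith
  · have h1 : (⌈Real.log (2 + L) / Real.log 2⌉₊ : ℝ) < Real.log (2 + L) / Real.log 2 + 1 :=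
      Nat.ceil_lt_add_one (div_nonneg (hlog2'.le.trans hlL) hlog2'.le)
    have h2 : Real.log (2 + L) / Real.log 2 ≤ 1.5 * Real.log (2 + L) := by
      rw [div_le_iff₀ hlog2']
      nlinarith
    push_cast
    linarith

end UpperBound

section Operators

variable {H : Type} [NormedAddCommGroup H] [InnerProductSpace ℂ H] [CompleteSpace H]

lemma opAbs_eq_of_sq {T S : H →L[ℂ] H} (hS : 0 ≤ S) (h : S * S = star T * T) : opAbs T = S := by
  have hsa : IsSelfAdjoint S := IsSelfAdjoint.of_nonneg hS
  have h1 : S * S = cfc (fun x : ℝ => x ^ 2) S := by rw [cfc_pow_id S 2, pow_two]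
  rw [opAbs, ← h, h1, ← cfc_comp' Real.sqrt (fun x : ℝ => x ^ 2) S]
  calc cfc (fun x : ℝ => √(x ^ 2)) S = cfc id S :=
        cfc_congr fun x hx => Real.sqrt_sq (spectrum_nonneg_of_nonneg hS hx)
    _ = S := cfc_id ℝ S

lemma opAbs_nonneg (T : H →L[ℂ] H) : 0 ≤ opAbs T :=
  cfc_nonneg fun x _ => Real.sqrt_nonneg x

lemma opAbs_mul_self (T : H →L[ℂ] H) : opAbs T * opAbs T = star T * T := by
  have h0 : (0 : H →L[ℂ] H) ≤ star T * T := star_mul_self_nonneg T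
  have hsa : IsSelfAdjoint (star T * T) := IsSelfAdjoint.star_mul_self T
  rw [opAbs, ← cfc_mul Real.sqrt Real.sqrt (star T * T)]
  calc cfc (fun x : ℝ => √x * √x) (star T * T) = cfc id (star T * T) :=
        cfc_congr fun x hx => Real.mul_self_sqrt (spectrum_nonneg_of_nonneg h0 hx)
    _ = star T * T := cfc_id ℝ _

/-- Conjugating by the Cayley transform of a small skew-adjoint `K` turns a commutator
estimate into a perturbation estimate. -/
theorem exists_unitary_perturbation {D K : H →L[ℂ] H} (hD : IsSelfAdjoint D)
    (hK : star K = -K) (hK1 : ‖K‖ ≤ 1 / 2) :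
    ∃ B : H →L[ℂ] H, IsSelfAdjoint B ∧ spectrum ℝ B = spectrum ℝ D ∧
      ‖D - B‖ ≤ 8 * ‖D * K - K * D‖ ∧
      ‖opAbs D * K - K * opAbs D‖ ≤ 9 / 8 * ‖opAbs D - opAbs B‖ := by
  set R : (H →L[ℂ] H)ˣ := Units.oneSub K (by linarith) with hR
  have hRv : (R : H →L[ℂ] H) = 1 - K := rfl
  obtain ⟨Q, hQ⟩ : ∃ Q : H →L[ℂ] H, Q = ↑R⁻¹ := ⟨_, rfl⟩
  have hQR : Q * (1 - K) = 1 := by rw [hQ, ← hRv]; exact R.inv_mul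
  have hRQ : (1 - K) * Q = 1 := by rw [hQ, ← hRv]; exact R.mul_inv
  have hone : ‖(1 : H →L[ℂ] H)‖ ≤ 1 := ContinuousLinearMap.norm_id_le
  have hQn : ‖Q‖ ≤ 2 := by
    have h1 : Q = 1 + K * Q := by rw [← hRQ]; noncomm_ring
    have h2 : ‖Q‖ ≤ 1 + 1 / 2 * ‖Q‖ := by
      calc ‖Q‖ = ‖1 + K * Q‖ := by rw [← h1]
        _ ≤ 1 + ‖K‖ * ‖Q‖ :=
            (norm_add_le _ _).trans (add_le_add hone (norm_mul_le _ _))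
        _ ≤ 1 + 1 / 2 * ‖Q‖ := by gcongr
    linarith
  have hRn : ‖1 - K‖ ≤ 3 / 2 := by
    calc ‖1 - K‖ ≤ ‖(1 : H →L[ℂ] H)‖ + ‖K‖ := norm_sub_le _ _
      _ ≤ 3 / 2 := by linarith
  have hsQ1 : (1 + K) * star Q = 1 := by
    have := congrArg star hQR
    rwa [star_mul, star_sub, star_one, hK, sub_neg_eq_add] at this
  have hsQ2 : star Q * (1 + K) = 1 := by
    have := congrArg star hRQ
    rwa [star_mul, star_sub, star_one, hK, sub_neg_eq_add] at this
  obtain ⟨U, hU⟩ : ∃ U : H →L[ℂ] H, U = 2 * Q - 1 := ⟨_, rfl⟩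
  have hU1 : U = (1 + K) * Q := by
    rw [hU]
    calc 2 * Q - 1 = 2 * Q - (1 - K) * Q := by rw [hRQ]
      _ = (1 + K) * Q := by noncomm_ring
  have hU2 : U = Q * (1 + K) := by
    rw [hU]
    calc 2 * Q - 1 = 2 * Q - Q * (1 - K) := by rw [hQR]
      _ = Q * (1 + K) := by noncomm_ring
  have hUs : star U = star Q * (1 - K) := by
    rw [hU1, star_mul, star_add, star_one, hK, ← sub_eq_add_neg]
  have hsUU : star U * U = 1 := by
    rw [hUs, hU1]
    calc star Q * (1 - K) * ((1 + K) * Q) = star Q * (1 + K) * ((1 - K) * Q) := by noncomm_ring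
      _ = 1 := by rw [hsQ2, hRQ, one_mul]
  have hUsU : U * star U = 1 := by
    rw [hUs, hU2]
    calc Q * (1 + K) * (star Q * (1 - K)) = Q * ((1 + K) * star Q) * (1 - K) := by noncomm_ring
      _ = 1 := by rw [hsQ1, mul_one, hQR]
  have hcomm : ∀ T : H →L[ℂ] H, U * T - T * U = -(2 * (Q * (T * K - K * T) * Q)) := by
    intro T
    have h1 : Q * T - T * Q = Q * (T * (1 - K) - (1 - K) * T) * Q := by
      calc Q * T - T * Q = Q * T * ((1 - K) * Q) - (Q * (1 - K)) * T * Q := by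
            rw [hRQ, hQR, mul_one, one_mul]
        _ = _ := by noncomm_ring
    calc U * T - T * U = 2 * (Q * T - T * Q) := by rw [hU]; noncomm_ring
      _ = _ := by rw [h1]; noncomm_ring
  have hnU : ‖U‖ ≤ 1 := by
    have h1 : ‖U‖ * ‖U‖ ≤ 1 := by rw [← CStarRing.norm_star_mul_self, hsUU]; exact hone
    nlinarith [norm_nonneg U]
  have hnsU : ‖star U‖ ≤ 1 := by rwa [norm_star]
  have habs : opAbs (star U * D * U) = star U * opAbs D * U := by
    refine opAbs_eq_of_sq (star_left_conjugate_nonneg (opAbs_nonneg D) U) ?_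
    calc star U * opAbs D * U * (star U * opAbs D * U)
        = star U * opAbs D * (U * star U) * opAbs D * U := by noncomm_ring
      _ = star U * (opAbs D * opAbs D) * U := by rw [hUsU]; noncomm_ring
      _ = star U * star D * (U * star U) * D * U := by
          rw [opAbs_mul_self, hUsU]; noncomm_ring
      _ = star (star U * D * U) * (star U * D * U) := by
          rw [star_mul, star_mul, star_star]; noncomm_ring
  refine ⟨star U * D * U, ?_, ?_, ?_, ?_⟩
  · rw [IsSelfAdjoint, star_mul, star_mul, star_star, hD.star_eq, mul_assoc]
  · exact Unitary.spectrum_star_left_conjugate (U := ⟨U, hsUU, hUsU⟩)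
  · have h1 : D - star U * D * U = star U * (U * D - D * U) := by
      calc D - star U * D * U = (star U * U) * D - star U * D * U := by rw [hsUU, one_mul]
        _ = _ := by noncomm_ring
    rw [h1, hcomm]
    calc _ ≤ ‖star U‖ * (2 * (‖Q‖ * ‖D * K - K * D‖ * ‖Q‖)) := by
          refine (norm_mul_le _ _).trans ?_
          gcongr
          rw [norm_neg, two_mul, two_mul]
          refine (norm_add_le _ _).trans ?_
          gcongr <;> exact (norm_mul_le _ _).trans (by gcongr; exact norm_mul_le _ _)
      _ ≤ 1 * (2 * (2 * ‖D * K - K * D‖ * 2)) := by gcongr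
      _ = _ := by ring
  · rw [habs]
    set P := opAbs D
    have h1 : U * P - P * U = U * (P - star U * P * U) := by
      calc U * P - P * U = U * P - (U * star U) * P * U := by rw [hUsU, one_mul]
        _ = _ := by noncomm_ring
    have h2 : (2 : ℂ) • (P * K - K * P) = -((1 - K) * (U * P - P * U) * (1 - K)) := by
      calc (2 : ℂ) • (P * K - K * P)
          = (2 : ℂ) • (((1 - K) * Q) * (P * K - K * P) * (Q * (1 - K))) := by
            rw [hRQ, hQR, one_mul, mul_one]
        _ = _ := by rw [hcomm, two_smul]; noncomm_ring
    have h3 : 2 * ‖P * K - K * P‖ ≤ 3 / 2 * (1 * ‖P - star U * P * U‖) * (3 / 2) := by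
      calc 2 * ‖P * K - K * P‖ = ‖(2 : ℂ) • (P * K - K * P)‖ := by rw [norm_smul]; norm_num
        _ ≤ ‖1 - K‖ * (‖U‖ * ‖P - star U * P * U‖) * ‖1 - K‖ := by
            rw [h2, norm_neg, h1]
            refine (norm_mul_le _ _).trans ?_
            gcongr
            refine (norm_mul_le _ _).trans ?_
            gcongr
            exact norm_mul_le _ _
        _ ≤ _ := by gcongr
    linarith

end Operators

section Transport

variable {H F : Type} [NormedAddCommGroup H] [InnerProductSpace ℂ H] [CompleteSpace H]
  [NormedAddCommGroup F] [InnerProductSpace ℂ F] [CompleteSpace F]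

/-- Extension by zero of an operator along an isometry. -/
noncomputable def extendZero (J : H →L[ℂ] F) (T : H →L[ℂ] H) : F →L[ℂ] F :=
  J ∘L T ∘L J.adjoint

variable {J : H →L[ℂ] F}

lemma star_extendZero (T : H →L[ℂ] H) : star (extendZero J T) = extendZero J (star T) := by
  simp only [extendZero, ContinuousLinearMap.star_eq_adjoint, ContinuousLinearMap.adjoint_comp,
    ContinuousLinearMap.adjoint_adjoint, ContinuousLinearMap.comp_assoc]

lemma extendZero_sub (S T : H →L[ℂ] H) :
    extendZero J (S - T) = extendZero J S - extendZero J T := by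
  ext x; simp [extendZero]

lemma extendZero_mul (hJ : J.adjoint ∘L J = 1) (S T : H →L[ℂ] H) :
    extendZero J S * extendZero J T = extendZero J (S * T) := by
  ext x
  have h : ∀ y, J.adjoint (J y) = y := fun y => congrArg (fun f : H →L[ℂ] H => f y) hJ
  simp [extendZero, mul_apply_eq_comp, h]

lemma extendZero_nonneg (hJ : J.adjoint ∘L J = 1) {T : H →L[ℂ] H} (hT : 0 ≤ T) :
    0 ≤ extendZero J T := by
  obtain ⟨S, rfl⟩ := CStarAlgebra.nonneg_iff_eq_star_mul_self.1 hT
  rw [← extendZero_mul hJ, ← star_extendZero]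
  exact star_mul_self_nonneg _

lemma opAbs_extendZero (hJ : J.adjoint ∘L J = 1) (T : H →L[ℂ] H) :
    opAbs (extendZero J T) = extendZero J (opAbs T) := by
  refine opAbs_eq_of_sq (extendZero_nonneg hJ (opAbs_nonneg T)) ?_
  rw [extendZero_mul hJ, star_extendZero, extendZero_mul hJ, opAbs_mul_self]

lemma spectrum_extendZero_subset (hJ : J.adjoint ∘L J = 1) (T : H →L[ℂ] H) :
    spectrum ℝ (extendZero J T) ⊆ insert 0 (spectrum ℝ T) := by
  intro x hx
  by_contra hcon
  rw [Set.mem_insert_iff, not_or, spectrum.notMem_iff] at hcon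
  obtain ⟨hx0, R, hR⟩ := hcon
  refine hx ?_
  have h : ∀ y, J.adjoint (J y) = y := fun y => congrArg (fun f : H →L[ℂ] H => f y) hJ
  obtain ⟨S, h1, h2⟩ : ∃ S : H →L[ℂ] H, (x • (1 : H →L[ℂ] H) - T) * S = 1 ∧
      S * (x • (1 : H →L[ℂ] H) - T) = 1 := by
    rw [← Algebra.algebraMap_eq_smul_one, ← hR]
    exact ⟨_, R.mul_inv, R.inv_mul⟩
  have h1' : ∀ y, T (S y) = x • S y - y := fun y => by
    have := congrArg (fun f : H →L[ℂ] H => f y) h1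
    simp [mul_apply_eq_comp] at this
    exact eq_sub_of_add_eq' (sub_eq_iff_eq_add.1 this).symm
  have h2' : ∀ y, S (T y) = x • S y - y := fun y => by
    have := congrArg (fun f : H →L[ℂ] H => f y) h2
    simp [mul_apply_eq_comp] at this
    exact eq_sub_of_add_eq' (sub_eq_iff_eq_add.1 this).symm
  have key : ∀ X Y : F →L[ℂ] F, X * Y = 1 → Y * X = 1 → IsUnit X := fun X Y h h' =>
    ⟨⟨X, Y, h, h'⟩, rfl⟩
  refine key _ (extendZero J S + x⁻¹ • (1 - extendZero J 1)) ?_ ?_ <;>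
  · ext y
    simp [extendZero, mul_apply_eq_comp, Algebra.algebraMap_eq_smul_one, h, h1', h2', smul_sub,
      smul_smul, hx0]

end Transport

section HilbertMatrix

open scoped Matrix.Norms.L2Operator

/-- The interlaced positions: even numbers on the left, odd numbers on the right. -/
def interlace (m : ℕ) : Fin m ⊕ Fin m → ℕ :=
  Sum.elim (fun p => 2 * p) (fun q => 2 * q + 1)

/-- The frequencies `0, …, 2M - 1`, in two halves. -/
def halfFreq (M : ℕ) : Fin M ⊕ Fin M → ℕ := Sum.elim (fun η => η) (fun η => M + η)

/-- The characters of `ℤ / 2M` with frequencies `halfFreq`, evaluated at the interlaced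
positions. -/
noncomputable def charMatrix (m M : ℕ) : Matrix (Fin M ⊕ Fin M) (Fin m ⊕ Fin m) ℂ :=
  Matrix.of fun ξ i => Complex.exp (-(Real.pi * interlace m i / M * halfFreq M ξ : ℝ) * Complex.I)

/-- The diagonal matrix with values `1` on the first half and `c` on the second half. -/
def signDiag (M : ℕ) (c : ℂ) : Matrix (Fin M ⊕ Fin M) (Fin M ⊕ Fin M) ℂ :=
  Matrix.diagonal (Sum.elim 1 fun _ => c)

lemma interlace_lt {m : ℕ} (i : Fin m ⊕ Fin m) : interlace m i < 2 * m := by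
  rcases i with p | p <;> simp only [interlace, Sum.elim_inl, Sum.elim_inr] <;>
    have := p.2 <;> omega

lemma interlace_injective (m : ℕ) : Function.Injective (interlace m) := by
  rintro (p | p) (q | q) h <;> simp only [interlace, Sum.elim_inl, Sum.elim_inr] at h <;>
    first | omega | (congr 1; ext; omega)

lemma conjTranspose_charMatrix_mul_apply {m M : ℕ} (hM : 0 < M) (c : ℂ) (i j : Fin m ⊕ Fin m) :
    ((charMatrix m M).conjTranspose * signDiag M c * charMatrix m M) i j =
      (1 + c * Complex.exp (Real.pi * ((interlace m i : ℂ) - interlace m j) * Complex.I)) *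
        ∑ η ∈ Finset.range M, Complex.exp (2 *
          (Real.pi * ((interlace m i : ℝ) - interlace m j) / (2 * M) : ℝ) * Complex.I) ^ η := by
  have hM' : (M : ℂ) ≠ 0 := by exact_mod_cast hM.ne'
  rw [Matrix.mul_apply]
  simp only [signDiag, Matrix.mul_diagonal, Matrix.conjTranspose_apply, charMatrix, Matrix.of_apply,
    Fintype.sum_sum_type, Sum.elim_inl, Sum.elim_inr, halfFreq, Pi.one_apply, mul_one]
  rw [add_mul, one_mul, Finset.mul_sum, ← Fin.sum_univ_eq_sum_range (fun η => _),
    ← Fin.sum_univ_eq_sum_range (fun η => _)]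
  congr 1 <;> refine Finset.sum_congr rfl fun η _ => ?_
  · rw [Complex.star_def, ← Complex.exp_conj, ← Complex.exp_add, ← Complex.exp_nat_mul]
    congr 1
    simp
    field_simp
    ring
  · rw [Complex.star_def, ← Complex.exp_conj, mul_right_comm, mul_comm _ c, mul_assoc, mul_assoc,
      ← Complex.exp_add, ← Complex.exp_nat_mul, ← Complex.exp_add]
    congr 2
    simp
    field_simp
    ring

lemma one_sub_exp_two_mul (x : ℝ) :
    1 - Complex.exp (2 * x * Complex.I) =
      2 * Real.sin x * (Real.sin x - Real.cos x * Complex.I) := by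
  have h : Complex.exp (2 * x * Complex.I) = (Complex.cos x + Complex.sin x * Complex.I) ^ 2 := by
    rw [← Complex.exp_mul_I, ← Complex.exp_nat_mul]; push_cast; ring_nf
  rw [h]
  push_cast
  have h1 := Complex.sin_sq_add_cos_sq x
  linear_combination (-Complex.sin x ^ 2) * Complex.I_sq - h1

lemma sin_ne_zero_of_abs_le_one {x : ℝ} (hx : x ≠ 0) (hx1 : |x| ≤ 1) : Real.sin x ≠ 0 := by
  rw [abs_le] at hx1
  rcases hx.lt_or_gt with h | h
  · exact (Real.sin_neg_of_neg_of_neg_pi_lt h (by linarith [Real.pi_gt_three])).ne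
  · exact (Real.sin_pos_of_pos_of_lt_pi h (by linarith [Real.pi_gt_three])).ne'

lemma half_le_mul_cot {x : ℝ} (hx : x ≠ 0) (hx1 : |x| ≤ 1) :
    1 / 2 ≤ x * (Real.cos x / Real.sin x) := by
  wlog h : 0 < x generalizing x
  · have := this (neg_ne_zero.2 hx) (by rwa [abs_neg]) (by
      rcases hx.lt_or_gt with h' | h' <;> [linarith; exact absurd h' h])
    simpa [Real.cos_neg, Real.sin_neg, div_neg] using this
  · rw [abs_le] at hx1
    have hs : 0 < Real.sin x := Real.sin_pos_of_pos_of_lt_pi h (by linarith [Real.pi_gt_three])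
    have hs' : Real.sin x ≤ x := Real.sin_le h.le
    have hc : 1 / 2 ≤ Real.cos x := by nlinarith [Real.one_sub_sq_div_two_le_cos (x := x)]
    rw [← mul_div_assoc, le_div_iff₀ hs]
    nlinarith

/-- A bounded self-adjoint matrix whose odd entries are comparable with the Hilbert kernel
`i / (j - k)`. -/
theorem exists_hilbertMatrix {m : ℕ} (hm : 0 < m) :
    ∃ Y : Matrix (Fin m ⊕ Fin m) (Fin m ⊕ Fin m) ℂ, Y.conjTranspose = Y ∧
      ‖Y‖ ≤ 1 ∧ (∀ i, Y i i = 0) ∧ ∀ p q : Fin m,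
        1 / 4 ≤ (2 * (p : ℝ) - (2 * q + 1)) * (Y (Sum.inl p) (Sum.inr q)).im := by
  set M : ℕ := 4 * m with hMdef
  have hM : 0 < M := by omega
  have hM' : (M : ℂ) ≠ 0 := by exact_mod_cast hM.ne'
  have hpi := Real.pi_pos
  set F := charMatrix m M
  set G : ℂ → Matrix (Fin m ⊕ Fin m) (Fin m ⊕ Fin m) ℂ := fun c =>
    F.conjTranspose * signDiag M c * F with hG
  set x : Fin m ⊕ Fin m → Fin m ⊕ Fin m → ℝ := fun i j =>
    Real.pi * ((interlace m i : ℝ) - interlace m j) / (2 * M) with hx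
  have hx0 : ∀ i j, i ≠ j → x i j ≠ 0 := by
    intro i j hij
    have : (interlace m i : ℝ) - interlace m j ≠ 0 :=
      sub_ne_zero.2 (Nat.cast_injective.ne ((interlace_injective m).ne hij))
    exact div_ne_zero (mul_ne_zero hpi.ne' this) (by positivity)
  have hx1 : ∀ i j, |x i j| ≤ 1 := by
    intro i j
    have h1 : |(interlace m i : ℝ) - interlace m j| ≤ 2 * m := by
      have hi : (interlace m i : ℝ) < 2 * m := by exact_mod_cast interlace_lt i
      have hj : (interlace m j : ℝ) < 2 * m := by exact_mod_cast interlace_lt j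
      have hi0 : (0 : ℝ) ≤ interlace m i := by positivity
      have hj0 : (0 : ℝ) ≤ interlace m j := by positivity
      rw [abs_le]; constructor <;> linarith
    have hm' : (0 : ℝ) < m := by exact_mod_cast hm
    have hM2 : (0 : ℝ) < 2 * M := by positivity
    rw [hx, abs_div, abs_mul, abs_of_pos hpi, abs_of_pos hM2, div_le_one hM2]
    calc _ ≤ 4 * (2 * (m : ℝ)) := by
          gcongr
          exact Real.pi_le_four
      _ = 2 * (M : ℝ) := by rw [hMdef]; push_cast; ring
  have hgeom : ∀ i j, (∑ η ∈ Finset.range M, Complex.exp (2 * (x i j : ℝ) * Complex.I) ^ η) *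
      (2 * Real.sin (x i j) * (Real.sin (x i j) - Real.cos (x i j) * Complex.I)) =
      1 - Complex.exp (Real.pi * ((interlace m i : ℂ) - interlace m j) * Complex.I) := by
    intro i j
    rw [← one_sub_exp_two_mul, mul_comm, mul_neg_geom_sum, ← Complex.exp_nat_mul]
    congr 2
    simp only [hx]
    push_cast
    field_simp
  have hsq : ∀ i j, Complex.exp (Real.pi * ((interlace m i : ℂ) - interlace m j) * Complex.I) ^ 2
      = 1 := by
    intro i j
    rw [← Complex.exp_nat_mul, Complex.exp_eq_one_iff]
    exact ⟨(interlace m i : ℤ) - interlace m j, by push_cast; ring⟩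
  have hsc : ∀ i j, i ≠ j →
      (Real.sin (x i j) : ℂ) - Real.cos (x i j) * Complex.I ≠ 0 := by
    intro i j hij h
    have := congrArg Complex.re h
    simp at this
    exact sin_ne_zero_of_abs_le_one (hx0 i j hij) (hx1 i j) this
  have hsc' : ∀ i j, i ≠ j → (Real.sin (x i j) : ℂ) ≠ 0 := fun i j hij => by
    exact_mod_cast sin_ne_zero_of_abs_le_one (hx0 i j hij) (hx1 i j)
  have hGval : ∀ c i j, G c i j =
      (1 + c * Complex.exp (Real.pi * ((interlace m i : ℂ) - interlace m j) * Complex.I)) *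
        ∑ η ∈ Finset.range M, Complex.exp (2 * (x i j : ℝ) * Complex.I) ^ η :=
    conjTranspose_charMatrix_mul_apply hM
  have hFF : F.conjTranspose * F =
      (2 * M : ℂ) • (1 : Matrix (Fin m ⊕ Fin m) (Fin m ⊕ Fin m) ℂ) := by
    have h1 : F.conjTranspose * F = G 1 := by
      have : signDiag M 1 = 1 := by
        rw [signDiag, ← Matrix.diagonal_one]
        congr 1
        ext (i | i) <;> rfl
      simp only [hG]
      rw [this, Matrix.mul_one]
    rw [h1]
    ext i j
    rw [hGval]
    rcases eq_or_ne i j with rfl | hij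
    · have : x i i = 0 := by simp [hx]
      rw [this]
      simp [one_add_one_eq_two]
    · have h2 := hgeom i j
      have h3 := hsq i j
      rw [Matrix.smul_apply, Matrix.one_apply_ne hij, smul_zero]
      have h4 := mul_ne_zero (mul_ne_zero two_ne_zero (hsc' i j hij)) (hsc i j hij)
      refine (mul_eq_zero.1 ?_).resolve_right h4
      rw [mul_assoc, h2]
      linear_combination -h3
  refine ⟨(2 * M : ℂ)⁻¹ • G (-1), ?_, ?_, ?_, ?_⟩
  · simp only [hG, signDiag, Matrix.conjTranspose_smul, Matrix.conjTranspose_mul,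
      Matrix.diagonal_conjTranspose, Matrix.conjTranspose_conjTranspose]
    congr 1
    · simp
    · rw [Matrix.mul_assoc]
      congr 3
      ext (i | i) <;> simp
  · have hF : ‖F‖ * ‖F‖ ≤ 2 * M := by
      rw [← Matrix.l2_opNorm_conjTranspose_mul_self, hFF, norm_smul]
      have : ‖(1 : Matrix (Fin m ⊕ Fin m) (Fin m ⊕ Fin m) ℂ)‖ ≤ 1 := by
        rw [← Matrix.diagonal_one, Matrix.l2_opNorm_diagonal]
        exact (pi_norm_le_iff_of_nonneg zero_le_one).2 fun i => by simp
      calc _ ≤ ‖(2 * M : ℂ)‖ * 1 := by gcongr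
        _ = 2 * M := by simp
    have hd : ‖signDiag M (-1)‖ ≤ 1 := by
      rw [signDiag, Matrix.l2_opNorm_diagonal]
      refine (pi_norm_le_iff_of_nonneg zero_le_one).2 ?_
      rintro (i | i) <;> simp
    have hGn : ‖G (-1)‖ ≤ 2 * M := by
      calc ‖G (-1)‖ ≤ ‖F.conjTranspose‖ * 1 * ‖F‖ := by
            refine (Matrix.l2_opNorm_mul _ _).trans ?_
            gcongr
            refine (Matrix.l2_opNorm_mul _ _).trans ?_
            gcongr
        _ = ‖F‖ * ‖F‖ := by rw [Matrix.l2_opNorm_conjTranspose, mul_one]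
        _ ≤ 2 * M := hF
    rw [norm_smul, norm_inv, inv_mul_le_iff₀ (by simp [hM])]
    simpa using hGn
  · intro i
    rw [Matrix.smul_apply, hGval]
    simp
  · intro p q
    have hne : (Sum.inl p : Fin m ⊕ Fin m) ≠ Sum.inr q := Sum.inl_ne_inr
    set s := x (Sum.inl p) (Sum.inr q) with hs
    have hs0 := hx0 _ _ hne
    have hs1 := hx1 (Sum.inl p) (Sum.inr q)
    have hodd : Complex.exp (Real.pi * ((interlace m (Sum.inl p) : ℂ) - interlace m (Sum.inr q)) *
        Complex.I) = -1 := by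
      have : Real.pi * ((interlace m (Sum.inl p) : ℂ) - interlace m (Sum.inr q)) * Complex.I
          = -(Real.pi * Complex.I) + ((p : ℤ) - q : ℤ) * (2 * Real.pi * Complex.I) := by
        simp only [interlace, Sum.elim_inl, Sum.elim_inr]
        push_cast
        ring
      rw [this, Complex.exp_add, Complex.exp_int_mul_two_pi_mul_I, mul_one, Complex.exp_neg,
        Complex.exp_pi_mul_I]
      norm_num
    have hval : ((2 * M : ℂ)⁻¹ • G (-1)) (Sum.inl p) (Sum.inr q) =
        ((M : ℝ)⁻¹ : ℝ) * (1 + (Real.cos s / Real.sin s : ℝ) * Complex.I) := by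
      have h2 := hgeom (Sum.inl p) (Sum.inr q)
      rw [hodd] at h2
      have h4 := mul_ne_zero (mul_ne_zero two_ne_zero (hsc' _ _ hne)) (hsc _ _ hne)
      rw [Matrix.smul_apply, hGval, hodd, smul_eq_mul,
        eq_div_of_mul_eq h4 h2]
      rw [← hs] at h4 ⊢
      have h5 := Real.sin_sq_add_cos_sq s
      have h6 : ((Real.sin s : ℝ) : ℂ) ≠ 0 := hsc' _ _ hne
      have h7 : ((Real.sin s : ℝ) : ℂ) - Real.cos s * Complex.I ≠ 0 := hsc _ _ hne
      have h8 : ((Real.sin s : ℝ) : ℂ) ^ 2 + (Real.cos s : ℂ) ^ 2 = 1 := by exact_mod_cast h5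
      rw [Complex.ofReal_div, Complex.ofReal_inv, Complex.ofReal_natCast]
      field_simp
      linear_combination (-4) * h8 + 4 * (Real.cos s : ℂ) ^ 2 * Complex.I_sq
    have him : (((2 * M : ℂ)⁻¹ • G (-1)) (Sum.inl p) (Sum.inr q)).im =
        (M : ℝ)⁻¹ * (Real.cos s / Real.sin s) := by
      rw [hval, Complex.im_ofReal_mul, Complex.add_im, Complex.im_ofReal_mul]
      simp
    have hk : 2 * (p : ℝ) - (2 * q + 1) = 2 * M * s / Real.pi := by
      simp only [hs, hx, interlace, Sum.elim_inl, Sum.elim_inr]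
      push_cast
      field_simp
    have hcot := half_le_mul_cot hs0 hs1
    rw [him, hk]
    calc (1 : ℝ) / 4 ≤ 1 / Real.pi := by gcongr; exact Real.pi_le_four
      _ = 2 / Real.pi * (1 / 2) := by ring
      _ ≤ 2 / Real.pi * (s * (Real.cos s / Real.sin s)) := by gcongr
      _ = _ := by field_simp

end HilbertMatrix

section LogSum

lemma half_log_le_sum_odd (s : ℕ) :
    Real.log (s + 1) / 2 ≤ ∑ p ∈ Finset.range s, 1 / (2 * (p : ℝ) + 1) := by
  have h := log_add_one_le_harmonic s
  rw [harmonic] at h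
  push_cast at h
  rw [div_le_iff₀ two_pos, Finset.sum_mul]
  refine h.trans (Finset.sum_le_sum fun p _ => ?_)
  rw [div_mul_eq_mul_div, one_mul, inv_eq_one_div, div_le_div_iff₀ (by positivity) (by positivity)]
  linarith

lemma half_log_le_sum_abs {m q : ℕ} (hq : q < m) :
    Real.log (m + 1) / 2 ≤ ∑ p ∈ Finset.range m, 1 / |2 * (p : ℝ) - (2 * q + 1)| := by
  obtain ⟨r, rfl⟩ : ∃ r, m = (q + 1) + r := ⟨m - (q + 1), by omega⟩
  rw [Finset.sum_range_add, ← Finset.sum_range_reflect]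
  have h1 : ∑ p ∈ Finset.range (q + 1), 1 / |2 * ((q + 1 - 1 - p : ℕ) : ℝ) - (2 * q + 1)|
      = ∑ p ∈ Finset.range (q + 1), 1 / (2 * (p : ℝ) + 1) := by
    refine Finset.sum_congr rfl fun p hp => ?_
    have hp' : p ≤ q := by rw [Finset.mem_range] at hp; omega
    rw [Nat.add_sub_cancel, Nat.cast_sub hp',
      show 2 * ((q : ℝ) - p) - (2 * q + 1) = -(2 * p + 1) by ring, abs_neg,
      abs_of_nonneg (by positivity)]
  have h2 : ∑ p ∈ Finset.range r, 1 / |2 * ((q + 1 + p : ℕ) : ℝ) - (2 * q + 1)|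
      = ∑ p ∈ Finset.range r, 1 / (2 * (p : ℝ) + 1) := by
    refine Finset.sum_congr rfl fun p _ => ?_
    push_cast
    rw [show 2 * ((q : ℝ) + 1 + p) - (2 * q + 1) = 2 * p + 1 by ring,
      abs_of_nonneg (by positivity)]
  rw [h1, h2]
  have h3 := half_log_le_sum_odd (q + 1)
  have h4 := half_log_le_sum_odd r
  have h5 : Real.log (((q + 1 + r : ℕ) : ℝ) + 1) ≤
      Real.log (((q + 1 : ℕ) : ℝ) + 1) + Real.log ((r : ℝ) + 1) := by
    rw [← Real.log_mul (by positivity) (by positivity)]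
    refine Real.log_le_log (by positivity) ?_
    push_cast
    have : (0 : ℝ) ≤ q * r := by positivity
    nlinarith [(Nat.cast_nonneg r : (0 : ℝ) ≤ r)]
  linarith

end LogSum

section FiniteExample

open scoped Matrix.Norms.L2Operator

lemma sum_im_le_mul_norm {m : ℕ} (Z : Matrix (Fin m ⊕ Fin m) (Fin m ⊕ Fin m) ℂ) :
    ∑ p, ∑ q, (Z (Sum.inl p) (Sum.inr q)).im ≤ m * ‖Z‖ := by
  set u : EuclideanSpace ℂ (Fin m ⊕ Fin m) := WithLp.toLp 2 (Sum.elim 1 0)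
  set v : EuclideanSpace ℂ (Fin m ⊕ Fin m) := WithLp.toLp 2 (Sum.elim 0 1)
  have hu : ‖u‖ = √m := by simp [u, EuclideanSpace.norm_eq]
  have hv : ‖v‖ = √m := by simp [v, EuclideanSpace.norm_eq]
  have h1 : inner ℂ u (Matrix.toEuclideanCLM (𝕜 := ℂ) Z v) =
      ∑ p, ∑ q, Z (Sum.inl p) (Sum.inr q) := by
    simp [u, v, PiLp.inner_apply, Matrix.toEuclideanCLM_toLp, Matrix.mulVec, dotProduct]
  have h2 : ‖(inner ℂ u (Matrix.toEuclideanCLM (𝕜 := ℂ) Z v) : ℂ)‖ ≤ m * ‖Z‖ := by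
    calc _ ≤ ‖u‖ * (‖Z‖ * ‖v‖) := (norm_inner_le_norm _ _).trans (by
          gcongr
          exact (Matrix.toEuclideanCLM (𝕜 := ℂ) Z).le_opNorm v)
      _ = (√m * √m) * ‖Z‖ := by rw [hu, hv]; ring
      _ = m * ‖Z‖ := by rw [Real.mul_self_sqrt (Nat.cast_nonneg m)]
  calc _ = (∑ p, ∑ q, Z (Sum.inl p) (Sum.inr q)).im := by simp [Complex.im_sum]
    _ ≤ _ := (Complex.im_le_norm _).trans (by rwa [← h1])

/-- The eigenvalues `a, -2a, 4a, -8a, …`, indexed along the interlaced positions. -/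
noncomputable def altEigenvalues (a : ℝ) (m : ℕ) : Fin m ⊕ Fin m → ℝ :=
  Sum.elim (fun p => a * 4 ^ (p : ℕ)) (fun q => -(2 * a * 4 ^ (q : ℕ)))

lemma altEigenvalues_injective {a : ℝ} (ha : 0 < a) (m : ℕ) :
    Function.Injective (altEigenvalues a m) := by
  have hpos : ∀ n : ℕ, 0 < a * 4 ^ n := fun n => by positivity
  rintro (p | p) (q | q) h <;> simp only [altEigenvalues, Sum.elim_inl, Sum.elim_inr] at h
  · congr 1
    exact Fin.ext (pow_right_injective₀ (by norm_num) (by norm_num) (mul_left_cancel₀ ha.ne' h))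
  · linarith [hpos p, hpos q]
  · linarith [hpos p, hpos q]
  · congr 1
    exact Fin.ext (pow_right_injective₀ (by norm_num) (by norm_num)
      (mul_left_cancel₀ (by positivity) (neg_injective h)))

/-- The divided difference of `|·|` at a positive and a negative eigenvalue is of constant size
and has the sign of the difference of the positions. -/
lemma third_abs_le_mul_ratio (p q : ℕ) :
    |2 * (p : ℝ) - (2 * q + 1)| / 3 ≤
      (2 * (p : ℝ) - (2 * q + 1)) * ((4 ^ p - 2 * 4 ^ q) / (4 ^ p + 2 * 4 ^ q)) := by
  have hp : (0 : ℝ) < 4 ^ p := by positivity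
  have hq : (0 : ℝ) < 4 ^ q := by positivity
  rcases le_or_gt p q with h | h
  · have h1 : (4 : ℝ) ^ p ≤ 4 ^ q := pow_le_pow_right₀ (by norm_num) h
    have h2 : 2 * (p : ℝ) - (2 * q + 1) ≤ 0 := by
      have : (p : ℝ) ≤ q := by exact_mod_cast h
      linarith
    have h3 : (4 ^ p - 2 * 4 ^ q : ℝ) / (4 ^ p + 2 * 4 ^ q) ≤ -(1 / 3) := by
      rw [div_le_iff₀ (by positivity)]
      linarith
    rw [abs_of_nonpos h2]
    nlinarith
  · have h1 : (4 : ℝ) ^ (q + 1) ≤ 4 ^ p := pow_le_pow_right₀ (by norm_num) h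
    have h2 : 0 ≤ 2 * (p : ℝ) - (2 * q + 1) := by
      have : (q : ℝ) + 1 ≤ p := by exact_mod_cast h
      linarith
    have h3 : 1 / 3 ≤ (4 ^ p - 2 * 4 ^ q : ℝ) / (4 ^ p + 2 * 4 ^ q) := by
      rw [pow_succ] at h1
      rw [le_div_iff₀ (by positivity)]
      linarith
    rw [abs_of_nonneg h2]
    nlinarith

lemma diagOp_eq_toEuclideanCLM {ι : Type*} [Fintype ι] [DecidableEq ι] (l : ι → ℝ) :
    diagOp ι ℂ l = Matrix.toEuclideanCLM (𝕜 := ℂ) (Matrix.diagonal fun i => (l i : ℂ)) := by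
  ext x i
  rw [diagOp_apply, Matrix.ofLp_toEuclideanCLM, Matrix.mulVec_diagonal, smul_eq_mul]

lemma opAbs_diagOp {ι : Type} [Fintype ι] (l : ι → ℝ) :
    opAbs (diagOp ι ℂ l) = diagOp ι ℂ |l| := by
  have hD : IsDiagonalRep (diagOp ι ℂ) := isDiagonalRep_diagOp
  refine opAbs_eq_of_sq ?_ ?_
  · have : |l| = (fun i => √|l i|) * (fun i => √|l i|) := by
      ext i
      exact (Real.mul_self_sqrt (abs_nonneg _)).symm
    rw [this, map_mul]
    nth_rewrite 1 [← hD.star_eq]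
    exact star_mul_self_nonneg _
  · rw [hD.star_eq, ← map_mul, ← map_mul]
    congr 1
    ext i
    exact abs_mul_abs_self (l i)

lemma spectrum_diagOp_subset {ι : Type} [Fintype ι] (l : ι → ℝ) :
    spectrum ℝ (diagOp ι ℂ l) ⊆ Set.range l := by
  refine (AlgHom.spectrum_apply_subset (diagOp ι ℂ) l).trans ?_
  rw [Pi.spectrum_eq]
  intro x hx
  obtain ⟨i, hi⟩ := Set.mem_iUnion.1 hx
  rw [show spectrum ℝ (l i) = {l i} from spectrum.scalar_eq (A := ℝ) (l i)] at hi
  exact ⟨i, hi.symm⟩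

theorem exists_finite_example {a : ℝ} (ha : 0 < a) {m : ℕ} (hm : 0 < m) :
    ∃ A B : EuclideanSpace ℂ (Fin m ⊕ Fin m) →L[ℂ] EuclideanSpace ℂ (Fin m ⊕ Fin m),
      IsSelfAdjoint A ∧ IsSelfAdjoint B ∧
      spectrum ℝ A ⊆ Set.Iic 0 ∪ Set.Icc a (a * 4 ^ (m - 1)) ∧
      spectrum ℝ B ⊆ Set.Iic 0 ∪ Set.Icc a (a * 4 ^ (m - 1)) ∧ A ≠ B ∧
      Real.log (m + 1) / 216 * ‖A - B‖ ≤ ‖opAbs A - opAbs B‖ := by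
  obtain ⟨Y, hYs, hYn, hY0, hYim⟩ := exists_hilbertMatrix hm
  have hm' : (0 : ℝ) < m := by exact_mod_cast hm
  set d := altEigenvalues a m with hd
  set Φ := Matrix.toEuclideanCLM (n := Fin m ⊕ Fin m) (𝕜 := ℂ)
  set K₀ : Matrix (Fin m ⊕ Fin m) (Fin m ⊕ Fin m) ℂ :=
    Matrix.of fun i j => Y i j / ((d i - d j : ℝ) : ℂ) with hK₀
  have hK₀s : K₀.conjTranspose = -K₀ := by
    ext i j
    have h1 : star (Y j i) = Y i j := by
      rw [← Matrix.conjTranspose_apply, hYs]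
    rw [Matrix.conjTranspose_apply, Matrix.neg_apply, hK₀, Matrix.of_apply, Matrix.of_apply,
      star_div₀, h1, Complex.star_def, Complex.conj_ofReal, ← neg_sub (d i) (d j),
      Complex.ofReal_neg, div_neg]
  obtain ⟨t, ht, htK⟩ : ∃ t : ℝ, 0 < t ∧ t * ‖K₀‖ ≤ 1 / 2 := by
    refine ⟨1 / (2 * (‖K₀‖ + 1)), by positivity, ?_⟩
    rw [div_mul_eq_mul_div, one_mul, div_le_div_iff₀ (by positivity) two_pos]
    linarith
  have hD : IsDiagonalRep (diagOp (Fin m ⊕ Fin m) ℂ) := isDiagonalRep_diagOp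
  set D := diagOp (Fin m ⊕ Fin m) ℂ d
  have hDs : IsSelfAdjoint D := hD.star_eq d
  have hKs : star (Φ ((t : ℂ) • K₀)) = -Φ ((t : ℂ) • K₀) := by
    rw [← map_star, Matrix.star_eq_conjTranspose, Matrix.conjTranspose_smul, hK₀s,
      Complex.star_def, Complex.conj_ofReal, smul_neg, map_neg]
  have hKn : ‖Φ ((t : ℂ) • K₀)‖ ≤ 1 / 2 := by
    rw [Matrix.l2_opNorm_toEuclideanCLM, norm_smul, Complex.norm_real, Real.norm_of_nonneg ht.le]
    exact htK
  obtain ⟨B, hBs, hBspec, hDB, hZB⟩ := exists_unitary_perturbation hDs hKs hKn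
  set Z : Matrix (Fin m ⊕ Fin m) (Fin m ⊕ Fin m) ℂ :=
    Matrix.of fun i j => ((|d i| - |d j| : ℝ) : ℂ) * K₀ i j with hZ
  have hDK : ∀ l : Fin m ⊕ Fin m → ℝ, diagOp _ ℂ l * Φ ((t : ℂ) • K₀) -
      Φ ((t : ℂ) • K₀) * diagOp _ ℂ l =
        Φ ((t : ℂ) • Matrix.of fun i j => ((l i - l j : ℝ) : ℂ) * K₀ i j) := by
    intro l
    rw [diagOp_eq_toEuclideanCLM, ← map_mul, ← map_mul, ← map_sub]
    congr 1
    ext i j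
    simp only [Matrix.sub_apply, Matrix.diagonal_mul, Matrix.mul_diagonal, Matrix.smul_apply,
      Matrix.of_apply, smul_eq_mul]
    push_cast
    ring
  have hnorm : ∀ X : Matrix (Fin m ⊕ Fin m) (Fin m ⊕ Fin m) ℂ, ‖Φ ((t : ℂ) • X)‖ = t * ‖X‖ := by
    intro X
    rw [Matrix.l2_opNorm_toEuclideanCLM, norm_smul, Complex.norm_real, Real.norm_of_nonneg ht.le]
  have hY' : (Matrix.of fun i j => ((d i - d j : ℝ) : ℂ) * K₀ i j) = Y := by
    ext i j
    rw [Matrix.of_apply, hK₀, Matrix.of_apply]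
    rcases eq_or_ne i j with rfl | hij
    · rw [hY0]; simp
    · have : ((d i - d j : ℝ) : ℂ) ≠ 0 := by
        exact_mod_cast sub_ne_zero.2 ((altEigenvalues_injective ha m).ne hij)
      rw [mul_div_cancel₀ _ this]
  rw [hDK d, hY', hnorm] at hDB
  rw [opAbs_diagOp, hDK |d|] at hZB
  have hZB' : t * ‖Z‖ ≤ 9 / 8 * ‖opAbs D - opAbs B‖ := by
    rw [opAbs_diagOp, ← hnorm]; exact hZB
  have hZim : ∀ p q : Fin m, 1 / 12 * (1 / |2 * (p : ℝ) - (2 * q + 1)|) ≤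
      (Z (Sum.inl p) (Sum.inr q)).im := by
    intro p q
    have h1 : Z (Sum.inl p) (Sum.inr q) =
        ((4 ^ (p : ℕ) - 2 * 4 ^ (q : ℕ)) / (4 ^ (p : ℕ) + 2 * 4 ^ (q : ℕ)) : ℝ) *
          Y (Sum.inl p) (Sum.inr q) := by
      have e1 : |d (Sum.inl p)| = a * 4 ^ (p : ℕ) := abs_of_pos (by simp [hd, altEigenvalues, ha])
      have e2 : |d (Sum.inr q)| = 2 * a * 4 ^ (q : ℕ) := by
        rw [hd, altEigenvalues, Sum.elim_inr, abs_neg, abs_of_pos (by positivity)]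
      have e3 : d (Sum.inl p) - d (Sum.inr q) = a * (4 ^ (p : ℕ) + 2 * 4 ^ (q : ℕ)) := by
        rw [hd, altEigenvalues, Sum.elim_inl, Sum.elim_inr]; ring
      rw [hZ, Matrix.of_apply, hK₀, Matrix.of_apply, e1, e2, e3, mul_div_left_comm, mul_comm,
        ← Complex.ofReal_div]
      congr 2
      have : (4 : ℝ) ^ (p : ℕ) + 2 * 4 ^ (q : ℕ) ≠ 0 := by positivity
      field_simp
    have h2 := hYim p q
    have h3 := third_abs_le_mul_ratio p q
    rw [h1, Complex.im_ofReal_mul]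
    set k := 2 * (p : ℝ) - (2 * q + 1) with hk
    set y := (Y (Sum.inl p) (Sum.inr q)).im
    set r : ℝ := (4 ^ (p : ℕ) - 2 * 4 ^ (q : ℕ)) / (4 ^ (p : ℕ) + 2 * 4 ^ (q : ℕ))
    have hk0 : k ≠ 0 := by rintro h; rw [h] at h2; norm_num at h2
    have hk1 : 0 < |k| := abs_pos.2 hk0
    have h4 : |k| / 3 * (1 / 4) ≤ (k * r) * (k * y) :=
      mul_le_mul h3 h2 (by norm_num) ((by positivity : (0 : ℝ) ≤ |k| / 3).trans h3)
    have h5 : (k * r) * (k * y) = |k| * |k| * (r * y) := by rw [abs_mul_abs_self]; ring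
    rw [h5] at h4
    rw [mul_one_div, div_le_iff₀ hk1]
    nlinarith
  have hZn : Real.log (m + 1) / 24 ≤ ‖Z‖ := by
    have h1 : (m : ℝ) * (Real.log (m + 1) / 24) ≤ m * ‖Z‖ := by
      refine le_trans ?_ (sum_im_le_mul_norm Z)
      calc (m : ℝ) * (Real.log (m + 1) / 24)
          = ∑ q : Fin m, 1 / 12 * (Real.log (m + 1) / 2) := by
            rw [Finset.sum_const, Finset.card_univ, Fintype.card_fin, nsmul_eq_mul]; ring
        _ ≤ ∑ q : Fin m, 1 / 12 * ∑ p : Fin m, 1 / |2 * (p : ℝ) - (2 * q + 1)| := by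
            gcongr with q
            rw [Fin.sum_univ_eq_sum_range fun p => 1 / |2 * (p : ℝ) - (2 * (q : ℕ) + 1)|]
            exact half_log_le_sum_abs q.2
        _ ≤ ∑ q : Fin m, ∑ p : Fin m, (Z (Sum.inl p) (Sum.inr q)).im := by
            gcongr with q
            rw [Finset.mul_sum]
            gcongr with p
            exact hZim p q
        _ = _ := Finset.sum_comm
    exact le_of_mul_le_mul_left h1 hm'
  have hlog : 0 < Real.log (m + 1) := Real.log_pos (by linarith)
  have hspec : spectrum ℝ D ⊆ Set.Iic 0 ∪ Set.Icc a (a * 4 ^ (m - 1)) := by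
    refine (spectrum_diagOp_subset d).trans ?_
    rintro _ ⟨p | q, rfl⟩
    · right
      rw [hd, altEigenvalues, Sum.elim_inl]
      refine ⟨le_mul_of_one_le_right ha.le (one_le_pow₀ (by norm_num)), ?_⟩
      gcongr
      · norm_num
      · have := p.2
        omega
    · left
      rw [hd, altEigenvalues, Sum.elim_inr, Set.mem_Iic, neg_nonpos]
      positivity
  have hmain : t * (Real.log (m + 1) / 24) ≤ 9 / 8 * ‖opAbs D - opAbs B‖ :=
    (by gcongr : t * (Real.log (m + 1) / 24) ≤ t * ‖Z‖).trans hZB'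
  have hDB' : ‖D - B‖ ≤ 8 * t := by nlinarith
  refine ⟨D, B, hDs, hBs, hspec, hBspec ▸ hspec, ?_, ?_⟩
  · rintro rfl
    rw [sub_self, norm_zero, mul_zero] at hmain
    have : 0 < t * (Real.log (m + 1) / 24) := by positivity
    linarith
  · calc Real.log (m + 1) / 216 * ‖D - B‖ ≤ Real.log (m + 1) / 216 * (8 * t) := by gcongr
      _ ≤ ‖opAbs D - opAbs B‖ := by linarith

end FiniteExample

section Main

lemma exists_isometry_ellTwo (ι : Type) [Fintype ι] :
    ∃ J : EuclideanSpace ℂ ι →L[ℂ] ellTwo, ∀ x, ‖J x‖ = ‖x‖ := by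
  obtain ⟨f, hf⟩ := Countable.exists_injective_nat ι
  let b : HilbertBasis ℕ ℂ ellTwo := HilbertBasis.ofRepr (LinearIsometryEquiv.refl ℂ _)
  have hb : Orthonormal ℂ fun i => b (f i) := b.orthonormal.comp f hf
  let e := EuclideanSpace.basisFun ι ℂ
  let J := (e.toBasis.constr ℂ fun i => b (f i)).isometryOfOrthonormal (v := e.toBasis)
    (by simp [e.orthonormal]) (by
      have : (e.toBasis.constr ℂ fun i => b (f i)) ∘ e.toBasis = fun i => b (f i) := by
        ext1 i
        exact e.toBasis.constr_basis ℂ _ i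
      rwa [this])
  exact ⟨J.toContinuousLinearMap, J.norm_map⟩

/-- The number of dyadic scales between `a` and `b`. -/
lemma exists_scale_count {a b : ℝ} (ha : 0 < a) (hab : a < b) :
    ∃ m : ℕ, 0 < m ∧ a * 4 ^ (m - 1) ≤ b ∧
      Real.log (2 + Real.log (b / a)) ≤ 2 * Real.log (m + 1) := by
  have hL : 0 < Real.log (b / a) := Real.log_pos ((one_lt_div ha).2 hab)
  have hlog4 : Real.log 4 = 2 * Real.log 2 := by
    rw [show (4 : ℝ) = 2 ^ 2 by norm_num, Real.log_pow]; norm_num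
  have h4 : 0 < Real.log 4 := Real.log_pos (by norm_num)
  have h4' : Real.log 4 < 2 := by rw [hlog4]; linarith [Real.log_two_lt_d9]
  set n := ⌊Real.log (b / a) / Real.log 4⌋₊ with hn
  refine ⟨n + 1, n.succ_pos, ?_, ?_⟩
  · have h1 : (n : ℝ) ≤ Real.log (b / a) / Real.log 4 :=
      Nat.floor_le (div_nonneg hL.le h4.le)
    rw [le_div_iff₀ h4, ← Real.log_pow,
      Real.log_le_log_iff (by positivity) (div_pos (ha.trans hab) ha), le_div_iff₀ ha] at h1
    rw [Nat.add_sub_cancel]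
    linarith
  · have h1 : Real.log (b / a) / Real.log 4 < n + 1 := Nat.lt_floor_add_one _
    rw [div_lt_iff₀ h4] at h1
    have hn0 : (0 : ℝ) ≤ n := Nat.cast_nonneg n
    have h2 : 2 + Real.log (b / a) ≤ (n + 1 + 1) ^ 2 := by nlinarith
    have h3 := Real.log_le_log (by linarith) h2
    rw [Real.log_pow] at h3
    push_cast at h3 ⊢
    exact h3

end Main

theorem stmt3 :
    ∃ C₁ C₂ : ℝ, 0 < C₁ ∧ 0 < C₂ ∧
      ∀ a b : ℝ, 0 < a → a < b →
        (∀ (H : Type) [NormedAddCommGroup H] [InnerProductSpace ℂ H] [CompleteSpace H]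
          (A B : H →L[ℂ] H), IsSelfAdjoint A → IsSelfAdjoint B →
          spectrum ℝ A ⊆ Set.Iic 0 ∪ Set.Icc a b →
          spectrum ℝ B ⊆ Set.Iic 0 ∪ Set.Icc a b →
          ‖opAbs A - opAbs B‖ ≤ C₂ * Real.log (2 + Real.log (b / a)) * ‖A - B‖) ∧
        (∃ A B : ellTwo →L[ℂ] ellTwo,
          IsSelfAdjoint A ∧ IsSelfAdjoint B ∧
          spectrum ℝ A ⊆ Set.Iic 0 ∪ Set.Icc a b ∧
          spectrum ℝ B ⊆ Set.Iic 0 ∪ Set.Icc a b ∧ A ≠ B ∧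
          C₁ * Real.log (2 + Real.log (b / a)) * ‖A - B‖ ≤ ‖opAbs A - opAbs B‖) := by
  refine ⟨1 / 432, 30, by norm_num, by norm_num, fun a b ha hab => ⟨?_, ?_⟩⟩
  · intro H _ _ _ A B hA hB hsA hsB
    obtain ⟨k, hk, hk'⟩ := exists_scale ha hab
    exact (norm_opAbs_sub_le hA hB ha hk hsA hsB).trans (by gcongr)
  · obtain ⟨m, hm, hmb, hlog⟩ := exists_scale_count ha hab
    obtain ⟨A, B, hA, hB, hsA, hsB, hne, hle⟩ := exists_finite_example ha hm
    obtain ⟨J, hJ⟩ := exists_isometry_ellTwo (Fin m ⊕ Fin m)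
    have hJJ : J.adjoint ∘L J = 1 := J.norm_map_iff_adjoint_comp_self.1 hJ
    have hnorm : ∀ T, ‖extendZero J T‖ = ‖T‖ := norm_conj_isometry hJ hJ
    have hspec : ∀ T, spectrum ℝ T ⊆ Set.Iic 0 ∪ Set.Icc a (a * 4 ^ (m - 1)) →
        spectrum ℝ (extendZero J T) ⊆ Set.Iic 0 ∪ Set.Icc a b := fun T hT =>
      (spectrum_extendZero_subset hJJ T).trans (Set.insert_subset (Or.inl Set.self_mem_Iic)
        (hT.trans (Set.union_subset_union_right _ (Set.Icc_subset_Icc_right hmb))))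
    refine ⟨extendZero J A, extendZero J B, ?_, ?_, hspec A hsA, hspec B hsB, ?_, ?_⟩
    · rw [IsSelfAdjoint, star_extendZero, hA.star_eq]
    · rw [IsSelfAdjoint, star_extendZero, hB.star_eq]
    · intro h
      rw [← sub_eq_zero, ← extendZero_sub, ← norm_eq_zero, hnorm, norm_eq_zero, sub_eq_zero] at h
      exact hne h
    · rw [opAbs_extendZero hJJ, opAbs_extendZero hJJ, ← extendZero_sub, ← extendZero_sub, hnorm,
        hnorm]
      refine le_trans ?_ hle
      gcongr
      linarith
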